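/- arXiv:2008.08638 — 2 statements merged into one kernel-verified Lean document; each statement's English description precedes it below -/
import Mathlib

section
/- Let X be an infinite, locally finite, connected, vertex-transitive graph containing a bi-infinite geodesic (x_n)_{n∈ℤ} with d(x_m,x_n) = |m − n|, and let 0 < α ≤ 1. Then X and X_α are not quasi-isometric: no quasi-isometric embedding f : X → X_α is coarsely surjective. -/
/-- `f` is an `(L,A)`-quasi-isometric embedding with respect to the
distance functions `dX` and `dY`. -/
def IsQIE {X Y : Type*} (dX : X → X → ℝ) (dY : Y → Y → ℝ) (L A : ℝ) (f : X → Y) : Prop :=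
  ∀ a b : X, (1 / L) * dX a b - A ≤ dY (f a) (f b) ∧ dY (f a) (f b) ≤ L * dX a b + A

/-- `f` is coarsely surjective with respect to the distance function `dY`. -/
def IsCoarselySurj {X Y : Type*} (dY : Y → Y → ℝ) (f : X → Y) : Prop :=
  ∃ C : ℝ, 0 ≤ C ∧ ∀ y : Y, ∃ x : X, dY y (f x) ≤ C

/-- The shortest-path distance of a graph, as a real-valued distance function. -/
noncomputable def gdist {V : Type*} (G : SimpleGraph V) : V → V → ℝ :=
  fun u v => (G.dist u v : ℝ)

/-- The closed ball of radius `r` about `x` in the shortest-path metric. -/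
def gball {V : Type*} (G : SimpleGraph V) (x : V) (r : ℕ) : Set V :=
  {v | G.dist x v ≤ r}

/-- `g_α(n) = ⌈(log n)^α⌉`, the length of the segment attached at `x_{n²}`. -/
noncomputable def glen (α : ℝ) (n : ℕ) : ℤ := ⌈Real.log (n : ℝ) ^ α⌉

/-- The vertex set of `X_α`: vertices of `X` together with the new segment vertices
`k_n` for `n ≥ 1` and `1 ≤ k ≤ g_α(n)`. -/
def XaV (α : ℝ) (V : Type*) : Type _ :=
  V ⊕ {p : ℕ × ℕ // 1 ≤ p.1 ∧ 1 ≤ p.2 ∧ (p.2 : ℤ) ≤ glen α p.1}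

/-- The adjacency relation of `X_α`: the adjacencies of `X`, the vertex `1_n` is
attached to `0_n = x_{n²}`, and `k_n` is adjacent to `(k+1)_n`. -/
def xaRel (α : ℝ) {V : Type*} (G : SimpleGraph V) (x : ℤ → V) :
    XaV α V → XaV α V → Prop
  | Sum.inl u, Sum.inl v => G.Adj u v
  | Sum.inl u, Sum.inr p => p.1.2 = 1 ∧ u = x ((p.1.1 : ℤ) ^ 2)
  | Sum.inr p, Sum.inl u => p.1.2 = 1 ∧ u = x ((p.1.1 : ℤ) ^ 2)
  | Sum.inr p, Sum.inr q => p.1.1 = q.1.1 ∧ (p.1.2 + 1 = q.1.2 ∨ q.1.2 + 1 = p.1.2)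

/-- The graph `X_α`, obtained from `X` by attaching, for each `n ≥ 1`, a segment of
length `g_α(n)` at the vertex `x_{n²}` of the chosen bi-infinite geodesic. -/
def Xa (α : ℝ) {V : Type*} (G : SimpleGraph V) (x : ℤ → V) : SimpleGraph (XaV α V) :=
  SimpleGraph.fromRel (xaRel α G x)

namespace SimpleGraph

/-- A real function changing by at most `1` along edges is `1`-Lipschitz for the path metric. -/
theorem Connected.abs_sub_le_dist {V : Type*} {G : SimpleGraph V} (hG : G.Connected) {F : V → ℝ}
    (hF : ∀ a b, G.Adj a b → |F a - F b| ≤ 1) (a b : V) : |F a - F b| ≤ G.dist a b := by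
  obtain ⟨w, hw⟩ := hG.exists_walk_length_eq_dist a b
  rw [← hw]
  clear hw
  induction w with
  | nil => simp
  | @cons u v w h p ih =>
    have h1 := hF _ _ h
    have h2 := abs_sub_le (F u) (F v) (F w)
    rw [Walk.length_cons]
    push_cast
    linarith

/-- A sequence moving along edges covers distance at most the number of steps. -/
theorem Connected.dist_seq_le {V : Type*} {G : SimpleGraph V} (hG : G.Connected) {p : ℕ → V}
    {T : ℕ} (hp : ∀ k < T, G.Adj (p k) (p (k + 1))) {k l : ℕ} (hkl : k ≤ l) (hl : l ≤ T) :
    G.dist (p k) (p l) ≤ l - k := by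
  induction l, hkl using Nat.le_induction with
  | base => simp
  | succ l hkl ih =>
    have h1 := ih (by omega)
    have h2 := hG.dist_triangle (u := p k) (v := p l) (w := p (l + 1))
    have h3 : G.dist (p l) (p (l + 1)) = 1 := dist_eq_one_iff_adj.2 (hp l (by omega))
    omega

theorem Iso.dist_map_le {V : Type*} {G : SimpleGraph V} (hG : G.Connected) (φ : G ≃g G)
    (a b : V) : G.dist (φ a) (φ b) ≤ G.dist a b := by
  obtain ⟨w, hw⟩ := hG.exists_walk_length_eq_dist a b
  rw [← hw, ← Walk.length_map φ.toHom w]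
  exact dist_le _

theorem Iso.dist_map_eq {V : Type*} {G : SimpleGraph V} (hG : G.Connected) (φ : G ≃g G)
    (a b : V) : G.dist (φ a) (φ b) = G.dist a b := by
  refine le_antisymm (Iso.dist_map_le hG φ a b) ?_
  simpa using Iso.dist_map_le hG φ.symm (φ a) (φ b)

end SimpleGraph

section Tripod

/-- A sequence of reals with steps at most `B` passes within `B` of every intermediate value. -/
theorem exists_abs_sub_le_of_steps {u : ℕ → ℝ} {B s : ℝ} (T : ℕ) (hB : 0 ≤ B)
    (hu : ∀ k < T, |u (k + 1) - u k| ≤ B) (h0 : u 0 ≤ s) (hT : s ≤ u T) :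
    ∃ k ≤ T, |u k - s| ≤ B := by
  induction T with
  | zero => exact ⟨0, le_rfl, by rw [le_antisymm h0 hT]; simpa⟩
  | succ T ih =>
    by_cases h : s ≤ u T
    · obtain ⟨k, hk, hk'⟩ := ih (fun k hk => hu k (by omega)) h
      exact ⟨k, by omega, hk'⟩
    · have := abs_le.1 (hu T (by omega))
      exact ⟨T + 1, le_rfl, abs_le.2 ⟨by linarith, by linarith⟩⟩

/-- Of two sequences with small steps issuing from a common point and ending above it,
one passes near the end of the other. -/
theorem false_of_two_arms_above {u v : ℕ → ℝ} {B : ℝ} {T : ℕ} (hB : 0 ≤ B)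
    (hu : ∀ k < T, |u (k + 1) - u k| ≤ B) (hv : ∀ k < T, |v (k + 1) - v k| ≤ B)
    (h0 : u 0 = v 0) (huv : ∀ k ≤ T, B < |u k - v T|) (hvu : ∀ k ≤ T, B < |v k - u T|)
    (hu0 : u 0 ≤ u T) (hv0 : v 0 ≤ v T) : False := by
  rcases le_total (u T) (v T) with h | h
  · obtain ⟨k, hk, hk'⟩ := exists_abs_sub_le_of_steps T hB hv (h0 ▸ hu0) h
    exact absurd hk' (not_le.2 (hvu k hk))
  · obtain ⟨k, hk, hk'⟩ := exists_abs_sub_le_of_steps T hB hu (h0 ▸ hv0) h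
    exact absurd hk' (not_le.2 (huv k hk))

/-- The real line contains no coarse tripod. -/
theorem false_of_three_arms {e : Fin 3 → ℕ → ℝ} {B : ℝ} {T : ℕ} (hB : 0 ≤ B)
    (hstep : ∀ i, ∀ k < T, |e i (k + 1) - e i k| ≤ B) (h0 : ∀ i j, e i 0 = e j 0)
    (hsep : ∀ i j, i ≠ j → ∀ k ≤ T, B < |e i k - e j T|) : False := by
  have hneg : ∀ a b : ℝ, |-a - -b| = |a - b| := fun a b => by
    rw [← abs_neg]; congr 1; ring
  have above : ∀ i j, i ≠ j → e i 0 ≤ e i T → e j 0 ≤ e j T → False := fun i j hij =>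
    false_of_two_arms_above hB (hstep i) (hstep j) (h0 i j) (hsep i j hij) (hsep j i hij.symm)
  have below : ∀ i j, i ≠ j → e i T ≤ e i 0 → e j T ≤ e j 0 → False := fun i j hij hi hj =>
    false_of_two_arms_above (u := fun k => -e i k) (v := fun k => -e j k) hB
      (by simpa only [hneg] using hstep i) (by simpa only [hneg] using hstep j)
      (congrArg Neg.neg (h0 i j)) (by simpa only [hneg] using hsep i j hij)
      (by simpa only [hneg] using hsep j i hij.symm) (neg_le_neg hi) (neg_le_neg hj)
  have h01 : (0 : Fin 3) ≠ 1 := by decide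
  have h02 : (0 : Fin 3) ≠ 2 := by decide
  have h12 : (1 : Fin 3) ≠ 2 := by decide
  rcases le_total (e 0 0) (e 0 T) with a | a <;> rcases le_total (e 1 0) (e 1 T) with b | b <;>
    rcases le_total (e 2 0) (e 2 T) with c | c
  · exact above _ _ h01 a b
  · exact above _ _ h01 a b
  · exact above _ _ h02 a c
  · exact below _ _ h12 b c
  · exact above _ _ h12 b c
  · exact below _ _ h02 a c
  · exact below _ _ h01 a b
  · exact below _ _ h01 a b

end Tripod

namespace Xa

variable {V : Type*} {G : SimpleGraph V} {x : ℤ → V} {α : ℝ}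

theorem exists_le_glen (hα : 0 < α) (T : ℕ) : ∃ n : ℕ, 1 ≤ n ∧ (T : ℤ) ≤ glen α n := by
  have h : Filter.Tendsto (fun n : ℕ => Real.log (n : ℝ) ^ α) Filter.atTop Filter.atTop :=
    (tendsto_rpow_atTop hα).comp (Real.tendsto_log_atTop.comp tendsto_natCast_atTop_atTop)
  obtain ⟨n, hn, hn1⟩ := ((h.eventually_ge_atTop (T : ℝ)).and (Filter.eventually_ge_atTop 1)).exists
  refine ⟨n, hn1, ?_⟩
  have : ((T : ℤ) : ℝ) ≤ (glen α n : ℝ) := by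
    rw [Int.cast_natCast]
    exact hn.trans (Int.le_ceil _)
  exact_mod_cast this

/-- The vertex `k_n` of `X_α`, with the convention `0_n = x_{n²}`. -/
noncomputable def hair (α : ℝ) (x : ℤ → V) (n k : ℕ) : XaV α V :=
  if h : 1 ≤ n ∧ 1 ≤ k ∧ (k : ℤ) ≤ glen α n then Sum.inr ⟨(n, k), h⟩
  else Sum.inl (x ((n : ℤ) ^ 2))

theorem hair_zero (n : ℕ) : hair α x n 0 = Sum.inl (x ((n : ℤ) ^ 2)) :=
  dif_neg (by simp)

theorem hair_of_pos {n k : ℕ} (h : 1 ≤ n ∧ 1 ≤ k ∧ (k : ℤ) ≤ glen α n) :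
    hair α x n k = Sum.inr ⟨(n, k), h⟩ :=
  dif_pos h

theorem adj_inl {u v : V} (h : G.Adj u v) : (Xa α G x).Adj (Sum.inl u) (Sum.inl v) := by
  refine (SimpleGraph.fromRel_adj _ _ _).2 ⟨fun e => h.ne (Sum.inl_injective e), Or.inl h⟩

theorem adj_hair {n k : ℕ} (hn : 1 ≤ n) (hk : ((k + 1 : ℕ) : ℤ) ≤ glen α n) :
    (Xa α G x).Adj (hair α x n k) (hair α x n (k + 1)) := by
  rw [hair_of_pos ⟨hn, by omega, hk⟩]
  rcases Nat.eq_zero_or_pos k with rfl | hpos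
  · rw [hair_zero]
    exact (SimpleGraph.fromRel_adj _ _ _).2 ⟨Sum.inl_ne_inr, Or.inl ⟨rfl, rfl⟩⟩
  · rw [hair_of_pos ⟨hn, hpos, by omega⟩]
    refine (SimpleGraph.fromRel_adj _ _ _).2 ⟨fun e => ?_, Or.inl ⟨rfl, Or.inl rfl⟩⟩
    have := congrArg (fun p => p.1.2) (Sum.inr_injective e)
    simp at this

theorem rel_of_adj {a b : XaV α V} (h : (Xa α G x).Adj a b) : xaRel α G x a b := by
  obtain ⟨-, h | h⟩ := (SimpleGraph.fromRel_adj _ _ _).1 h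
  · exact h
  · rcases a with a | a <;> rcases b with b | b
    · exact SimpleGraph.Adj.symm h
    · exact h
    · exact h
    · exact ⟨h.1.symm, h.2.symm⟩

theorem connected (hG : G.Connected) : (Xa α G x).Connected := by
  obtain ⟨v₀⟩ := hG.nonempty
  have hinl : ∀ u : V, (Xa α G x).Reachable (Sum.inl v₀) (Sum.inl u) := fun u =>
    (hG.preconnected v₀ u).map ⟨Sum.inl, adj_inl⟩
  have hhair : ∀ n k : ℕ, 1 ≤ n → (k : ℤ) ≤ glen α n →
      (Xa α G x).Reachable (Sum.inl v₀) (hair α x n k) := by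
    intro n k hn
    induction k with
    | zero => intro _; rw [hair_zero]; exact hinl _
    | succ k ih => exact fun hk => (ih (by omega)).trans (adj_hair hn hk).reachable
  refine SimpleGraph.connected_iff_exists_forall_reachable _ |>.2 ⟨Sum.inl v₀, ?_⟩
  rintro (u | ⟨⟨n, k⟩, h⟩)
  · exact hinl u
  · rw [← hair_of_pos (x := x) h]
    exact hhair n k h.1 h.2.2

/-- The height of a vertex along the `n`-th attached segment. -/
def height (n : ℕ) : XaV α V → ℝ
  | Sum.inl _ => 0
  | Sum.inr p => if p.1.1 = n then p.1.2 else 0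

/-- The retraction of `X_α` onto `X` collapsing the attached segments. -/
def retract (x : ℤ → V) : XaV α V → V
  | Sum.inl u => u
  | Sum.inr p => x ((p.1.1 : ℤ) ^ 2)

theorem height_hair {n k : ℕ} (hn : 1 ≤ n) (hk : (k : ℤ) ≤ glen α n) :
    height n (hair α x n k) = k := by
  rcases Nat.eq_zero_or_pos k with rfl | hpos
  · simp [hair_zero, height]
  · simp [hair_of_pos ⟨hn, hpos, hk⟩, height]

theorem retract_hair (n k : ℕ) : retract x (hair α x n k) = x ((n : ℤ) ^ 2) := by
  by_cases h : 1 ≤ n ∧ 1 ≤ k ∧ (k : ℤ) ≤ glen α n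
  · rw [hair_of_pos h]
    rfl
  · exact congrArg (retract x) (dif_neg h : hair α x n k = Sum.inl (x ((n : ℤ) ^ 2)))

theorem exists_eq_hair_of_height_pos {n : ℕ} {a : XaV α V} (h : 0 < height n a) :
    ∃ k : ℕ, (k : ℤ) ≤ glen α n ∧ a = hair α x n k := by
  rcases a with a | ⟨⟨m, k⟩, hp⟩
  · exact absurd h (lt_irrefl _)
  · by_cases hm : m = n
    · subst hm
      exact ⟨k, hp.2.2, (hair_of_pos hp).symm⟩
    · simp [height, hm] at h

theorem abs_height_sub_le_dist (hG : G.Connected) (n : ℕ) (a b : XaV α V) :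
    |height n a - height n b| ≤ (Xa α G x).dist a b := by
  refine (connected hG).abs_sub_le_dist (fun a b h => ?_) a b
  have h := rel_of_adj h
  rcases a with a | ⟨⟨m, k⟩, hp⟩ <;> rcases b with b | ⟨⟨m', k'⟩, hp'⟩
  · simp [height]
  · obtain ⟨h1, -⟩ := h
    simp only at h1
    subst h1
    simp only [height]
    split_ifs <;> simp
  · obtain ⟨h1, -⟩ := h
    simp only at h1
    subst h1
    simp only [height]
    split_ifs <;> simp
  · obtain ⟨h1, h2⟩ := h
    simp only at h1 h2
    subst h1
    simp only [height]
    split_ifs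
    · rcases h2 with rfl | rfl <;> simp
    · simp

theorem dist_retract_le (hG : G.Connected) (a b : XaV α V) :
    (G.dist (retract x a) (retract x b) : ℝ) ≤ (Xa α G x).dist a b := by
  have key := (connected (x := x) (α := α) hG).abs_sub_le_dist
    (F := fun c => (G.dist (retract x a) (retract x c) : ℝ)) (fun c d h => ?_) a b
  · simpa using key
  · have h := rel_of_adj h
    have hle : G.dist (retract x c) (retract x d) ≤ 1 := by
      rcases c with c | c <;> rcases d with d | d
      · exact (SimpleGraph.dist_eq_one_iff_adj.2 h).le
      · simp [retract, h.2]
      · simp [retract, h.2]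
      · simp [retract, h.1]
    have h1 := hG.dist_triangle (u := retract x a) (v := retract x c) (w := retract x d)
    have h2 := hG.dist_triangle (u := retract x a) (v := retract x d) (w := retract x c)
    rw [G.dist_comm (u := retract x d)] at h2
    have h3 : G.dist (retract x a) (retract x c) ≤ G.dist (retract x a) (retract x d) + 1 := by
      omega
    have h4 : G.dist (retract x a) (retract x d) ≤ G.dist (retract x a) (retract x c) + 1 := by
      omega
    have h5 : (G.dist (retract x a) (retract x c) : ℝ) ≤
      G.dist (retract x a) (retract x d) + 1 := by exact_mod_cast h3
    have h6 : (G.dist (retract x a) (retract x d) : ℝ) ≤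
      G.dist (retract x a) (retract x c) + 1 := by exact_mod_cast h4
    exact abs_le.2 ⟨by linarith, by linarith⟩

theorem dist_hair_le (hG : G.Connected) {n k l : ℕ} (hn : 1 ≤ n) (hk : (k : ℤ) ≤ glen α n)
    (hl : (l : ℤ) ≤ glen α n) :
    ((Xa α G x).dist (hair α x n k) (hair α x n l) : ℝ) ≤ |(k : ℝ) - l| := by
  wlog hkl : k ≤ l generalizing k l
  · rw [SimpleGraph.dist_comm, abs_sub_comm]
    exact this hl hk (by omega)
  have h := (connected (x := x) (α := α) hG).dist_seq_le (p := hair α x n) (T := l)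
    (fun i hi => adj_hair hn (by omega)) hkl le_rfl
  rw [abs_sub_comm, abs_of_nonneg (by simpa using hkl), ← Nat.cast_sub hkl]
  exact_mod_cast h

/-- The three arms issuing from `x_{n²}`: both sides of the geodesic and the attached segment. -/
noncomputable def arm (α : ℝ) (x : ℤ → V) (n : ℕ) (i : Fin 3) (k : ℕ) : XaV α V :=
  ![Sum.inl (x ((n : ℤ) ^ 2 + k)), Sum.inl (x ((n : ℤ) ^ 2 - k)), hair α x n k] i

theorem arm_zero (n : ℕ) (i : Fin 3) : arm α x n i 0 = Sum.inl (x ((n : ℤ) ^ 2)) := by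
  fin_cases i
  · exact congrArg (fun m => Sum.inl (x m)) (by simp)
  · exact congrArg (fun m => Sum.inl (x m)) (by simp)
  · exact hair_zero n

theorem adj_arm (hgeo : ∀ m n : ℤ, G.dist (x m) (x n) = (m - n).natAbs) {n k : ℕ} (hn : 1 ≤ n)
    (hk : ((k + 1 : ℕ) : ℤ) ≤ glen α n) (i : Fin 3) :
    (Xa α G x).Adj (arm α x n i k) (arm α x n i (k + 1)) := by
  fin_cases i
  · exact adj_inl (SimpleGraph.dist_eq_one_iff_adj.1 (by rw [hgeo]; push_cast; omega))
  · exact adj_inl (SimpleGraph.dist_eq_one_iff_adj.1 (by rw [hgeo]; push_cast; omega))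
  · exact adj_hair hn hk

theorem le_dist_arm (hG : G.Connected)
    (hgeo : ∀ m n : ℤ, G.dist (x m) (x n) = (m - n).natAbs) {n k T : ℕ} (hn : 1 ≤ n)
    (hT : (T : ℤ) ≤ glen α n) {i j : Fin 3} (hij : i ≠ j) :
    (T : ℝ) ≤ (Xa α G x).dist (arm α x n i k) (arm α x n j T) := by
  have hr := dist_retract_le (x := x) hG (arm α x n i k) (arm α x n j T)
  have hh := abs_height_sub_le_dist (x := x) hG n (arm α x n i k) (arm α x n j T)
  have of_le : ∀ {m : ℕ}, T ≤ m → (m : ℝ) ≤ (Xa α G x).dist (arm α x n i k) (arm α x n j T) →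
      (T : ℝ) ≤ (Xa α G x).dist (arm α x n i k) (arm α x n j T) := fun h h' =>
    (Nat.cast_le.2 h).trans h'
  fin_cases i <;> fin_cases j
  all_goals first | exact absurd rfl hij | skip
  · refine of_le ?_ hr
    change T ≤ G.dist (x _) (x _)
    rw [hgeo]; omega
  · have e : height n (hair α x n T) = T := height_hair hn hT
    change |0 - height n (hair α x n T)| ≤ _ at hh
    rw [e] at hh
    simpa using hh
  · refine of_le ?_ hr
    change T ≤ G.dist (x _) (x _)
    rw [hgeo]; omega
  · have e : height n (hair α x n T) = T := height_hair hn hT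
    change |0 - height n (hair α x n T)| ≤ _ at hh
    rw [e] at hh
    simpa using hh
  · refine of_le ?_ hr
    change T ≤ G.dist (retract x (hair α x n k)) (x _)
    rw [retract_hair, hgeo]; omega
  · refine of_le ?_ hr
    change T ≤ G.dist (retract x (hair α x n k)) (x _)
    rw [retract_hair, hgeo]; omega

/-- If a vertex-transitive `X` maps quasi-isometrically onto `X_α`, then every ball of `X`
embeds quasi-isometrically in the line, with uniform constants. -/
theorem exists_ball_embedding (hG : G.Connected) (htrans : ∀ u v : V, ∃ φ : G ≃g G, φ u = v)
    (hα : 0 < α) {L A C : ℝ} {f : V → XaV α V} (hL : 1 ≤ L)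
    (hf : IsQIE (gdist G) (gdist (Xa α G x)) L A f)
    (hC : ∀ y, ∃ u, gdist (Xa α G x) y (f u) ≤ C) (v : V) (R : ℝ) :
    ∃ ψ : V → ℝ, ∀ a b, gdist G v a ≤ R → gdist G v b ≤ R →
      1 / L * gdist G a b - A ≤ |ψ a - ψ b| ∧ |ψ a - ψ b| ≤ L * gdist G a b + A := by
  obtain ⟨N, hN⟩ := exists_nat_gt (C + (L * R + A))
  obtain ⟨n, hn, hNn⟩ := exists_le_glen hα N
  obtain ⟨u, hu⟩ := hC (hair α x n N)
  obtain ⟨φ, hφ⟩ := htrans v u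
  have hφd : ∀ a b, gdist G (φ a) (φ b) = gdist G a b := fun a b => by
    simp only [gdist, SimpleGraph.Iso.dist_map_eq hG φ a b]
  have hmem : ∀ a, gdist G v a ≤ R → ∃ k : ℕ, (k : ℤ) ≤ glen α n ∧ f (φ a) = hair α x n k := by
    intro a ha
    apply exists_eq_hair_of_height_pos
    have h1 := (hf u (φ a)).2
    rw [← hφ, hφd, hφ] at h1
    have h2 := abs_height_sub_le_dist (G := G) (x := x) hG n (hair α x n N) (f (φ a))
    rw [height_hair hn hNn] at h2
    have h3 : ((Xa α G x).dist (hair α x n N) (f (φ a)) : ℝ) ≤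
        (Xa α G x).dist (hair α x n N) (f u) + (Xa α G x).dist (f u) (f (φ a)) := by
      exact_mod_cast (connected hG).dist_triangle
    have h4 : L * gdist G v a ≤ L * R := mul_le_mul_of_nonneg_left ha (by linarith)
    simp only [gdist] at hu h1 h4
    linarith [(abs_le.1 h2).2]
  refine ⟨fun a => height n (f (φ a)), fun a b ha hb => ?_⟩
  have hab := hf (φ a) (φ b)
  rw [hφd] at hab
  refine ⟨hab.1.trans ?_, (abs_height_sub_le_dist hG n _ _).trans hab.2⟩
  obtain ⟨k, hk, hka⟩ := hmem a ha
  obtain ⟨l, hl, hlb⟩ := hmem b hb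
  simp only [hka, hlb, height_hair hn hk, height_hair hn hl]
  exact dist_hair_le hG hn hk hl

end Xa

/-- if `X` is moreover vertex-transitive, then `X` and `X_α` are not
quasi-isometric: no quasi-isometric embedding `f : X → X_α` is coarsely surjective. -/
theorem stmt12 {V : Type*} (G : SimpleGraph V) [Infinite V]
    (hlf : ∀ v : V, (G.neighborSet v).Finite) (hconn : G.Connected)
    (htrans : ∀ u v : V, ∃ φ : G ≃g G, φ u = v)
    (x : ℤ → V) (hgeo : ∀ m n : ℤ, G.dist (x m) (x n) = (m - n).natAbs)
    (α : ℝ) (hα : 0 < α) (hα1 : α ≤ 1) :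
    ¬ ∃ (L A : ℝ) (f : V → XaV α V), 1 ≤ L ∧ 0 ≤ A ∧
      IsQIE (gdist G) (gdist (Xa α G x)) L A f ∧
      IsCoarselySurj (gdist (Xa α G x)) f := by
  rintro ⟨L, A, f, hL, hA, hf, C, hC0, hC⟩
  have hL0 : 0 < L := by linarith
  choose h hh using hC
  have hXa := Xa.connected (x := x) (α := α) hconn
  have htri : ∀ a b c, gdist (Xa α G x) a c ≤ gdist (Xa α G x) a b + gdist (Xa α G x) b c :=
    fun a b c => by
      unfold gdist
      exact_mod_cast hXa.dist_triangle
  have hsymm : ∀ a b, gdist (Xa α G x) a b = gdist (Xa α G x) b a := fun a b => by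
    simp only [gdist, SimpleGraph.dist_comm]
  have hupper : ∀ y z, gdist G (h y) (h z) ≤ L * (gdist (Xa α G x) y z + (2 * C + A)) := by
    intro y z
    have h1 := (hf (h y) (h z)).1
    have h2 := htri (f (h y)) y (f (h z))
    have h3 := htri y z (f (h z))
    have h4 := hsymm (f (h y)) y
    rw [← div_le_iff₀' hL0, div_eq_inv_mul, ← one_div]
    linarith [hh y, hh z]
  have hlower : ∀ y z, gdist (Xa α G x) y z ≤ L * gdist G (h y) (h z) + (2 * C + A) := by
    intro y z
    have h1 := (hf (h y) (h z)).2
    have h2 := htri y (f (h y)) z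
    have h3 := htri (f (h y)) (f (h z)) z
    have h4 := hsymm (f (h z)) z
    linarith [hh y, hh z]
  set B : ℝ := L * (L * (1 + (2 * C + A))) + A with hBdef
  have hB : 0 ≤ B := by positivity
  obtain ⟨T, hT⟩ := exists_nat_gt (L * (L * (B + A)) + (2 * C + A))
  obtain ⟨n, hn, hTn⟩ := Xa.exists_le_glen hα T
  have hadj : ∀ i, ∀ k < T, (Xa α G x).Adj (Xa.arm α x n i k) (Xa.arm α x n i (k + 1)) :=
    fun i k hk => Xa.adj_arm hgeo hn (by omega) i
  obtain ⟨ψ, hψ⟩ := Xa.exists_ball_embedding hconn htrans hα hL hf (fun y => ⟨h y, hh y⟩)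
    (h (Sum.inl (x ((n : ℤ) ^ 2)))) (L * (T + (2 * C + A)))
  have hball : ∀ i, ∀ k ≤ T, gdist G (h (Sum.inl (x ((n : ℤ) ^ 2)))) (h (Xa.arm α x n i k)) ≤
      L * (T + (2 * C + A)) := by
    intro i k hk
    refine (hupper _ _).trans (mul_le_mul_of_nonneg_left ?_ hL0.le)
    have h1 := hXa.dist_seq_le (hadj i) (Nat.zero_le k) hk
    rw [Xa.arm_zero] at h1
    have h2 : gdist (Xa α G x) (Sum.inl (x ((n : ℤ) ^ 2))) (Xa.arm α x n i k) ≤ T := by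
      unfold gdist
      exact_mod_cast h1.trans (by omega)
    linarith
  refine false_of_three_arms (e := fun i k => ψ (h (Xa.arm α x n i k))) (T := T) hB
    (fun i k hk => ?_) (fun i j => by simp only [Xa.arm_zero]) (fun i j hij k hk => ?_)
  · refine (hψ _ _ (hball i _ (by omega)) (hball i _ (by omega))).2.trans ?_
    have h1 := hupper (Xa.arm α x n i (k + 1)) (Xa.arm α x n i k)
    have h2 : gdist (Xa α G x) (Xa.arm α x n i (k + 1)) (Xa.arm α x n i k) = 1 := by
      unfold gdist
      exact_mod_cast SimpleGraph.dist_eq_one_iff_adj.2 (hadj i k hk).symm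
    rw [h2] at h1
    have h3 := mul_le_mul_of_nonneg_left h1 hL0.le
    linarith
  · refine lt_of_lt_of_le ?_ (hψ _ _ (hball i k hk) (hball j T le_rfl)).1
    have h1 := hlower (Xa.arm α x n i k) (Xa.arm α x n j T)
    have h2 : (T : ℝ) ≤ gdist (Xa α G x) (Xa.arm α x n i k) (Xa.arm α x n j T) :=
      Xa.le_dist_arm hconn hgeo hn hTn hij
    have h3 : L * (B + A) < gdist G (h (Xa.arm α x n i k)) (h (Xa.arm α x n j T)) :=
      lt_of_mul_lt_mul_left (by linarith) hL0.le
    rw [lt_sub_iff_add_lt, one_div, ← div_eq_inv_mul, lt_div_iff₀' hL0]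
    exact h3
end

section
/- Let X be an infinite, locally finite, connected, vertex-transitive graph. Then there exists a family (G_α) of connected, locally finite, 3-regular graphs indexed by the real numbers α ∈ (0,1] such that: (i) for α ≠ β, G_α and G_β are not quasi-isometric; (ii) each G_α has the same cardinality of ends as X; and (iii) each G_α has growth function equivalent to that of X. In particular, there exist continuum many pairwise non-quasi-isometric 3-regular graphs with the same growth rate and number of ends as X. -/
namespace SimpleGraph

section Distance

variable {V : Type*} {G : SimpleGraph V}

/-- A function growing by at most one along edges grows at most by the distance. -/
lemma Connected.le_add_dist (hG : G.Connected) (φ : V → ℤ)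
    (hφ : ∀ a b, G.Adj a b → φ b ≤ φ a + 1) (a b : V) : φ b ≤ φ a + G.dist a b := by
  obtain ⟨p, hp⟩ := hG.exists_walk_length_eq_dist a b
  rw [← hp]
  clear hp
  induction p with
  | nil => simp
  | cons h p ih =>
    have := hφ _ _ h
    push_cast [Walk.length_cons]
    linarith

/-- A geodesic between two vertices, as a sequence of vertices. -/
lemma Connected.exists_geodesic (hG : G.Connected) (a b : V) :
    ∃ c : ℕ → V, c 0 = a ∧ c (G.dist a b) = b ∧
      (∀ i, G.dist (c i) (c (i + 1)) ≤ 1) ∧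
      (∀ i ≤ G.dist a b, G.dist a (c i) = i) ∧
      (∀ i ≤ G.dist a b, G.dist (c i) b = G.dist a b - i) := by
  obtain ⟨p, hp⟩ := hG.exists_walk_length_eq_dist a b
  have h1 : ∀ i ≤ G.dist a b, G.dist a (p.getVert i) ≤ i := fun i hi => by
    have := dist_le (p.take i)
    simp only [Walk.take_length] at this
    omega
  have h2 : ∀ i ≤ G.dist a b, G.dist (p.getVert i) b ≤ G.dist a b - i := fun i hi => by
    have := dist_le (p.drop i)
    simp only [Walk.drop_length] at this
    omega
  refine ⟨p.getVert, by simp, by rw [← hp]; simp, fun i => ?_, fun i hi => ?_, fun i hi => ?_⟩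
  · rcases lt_or_ge i p.length with h | h
    · exact (dist_eq_one_iff_adj.mpr (p.adj_getVert_succ h)).le
    · rw [p.getVert_of_length_le h, p.getVert_of_length_le (by omega)]
      simp
  · have := hG.dist_triangle (u := a) (v := p.getVert i) (w := b)
    have := h1 i hi
    have := h2 i hi
    omega
  · have := hG.dist_triangle (u := a) (v := p.getVert i) (w := b)
    have := h1 i hi
    have := h2 i hi
    omega

lemma Hom.dist_le {W : Type*} {H : SimpleGraph W} (hG : G.Connected) (f : G →g H) (a b : V) :
    H.dist (f a) (f b) ≤ G.dist a b := by
  obtain ⟨p, hp⟩ := hG.exists_walk_length_eq_dist a b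
  rw [← hp, ← Walk.length_map f]
  exact SimpleGraph.dist_le _

lemma Connected.finite_gball (hG : G.Connected) (hlf : ∀ v, (G.neighborSet v).Finite)
    (o : V) (n : ℕ) : (gball G o n).Finite := by
  induction n with
  | zero =>
    refine (Set.finite_singleton o).subset fun v hv => ?_
    simpa [gball, hG.dist_eq_zero_iff, eq_comm] using hv
  | succ n ih =>
    refine (ih.union (ih.biUnion fun v _ => hlf v)).subset fun v hv => ?_
    obtain ⟨c, -, hc, hs, h, -⟩ := hG.exists_geodesic o v
    rcases Nat.lt_or_ge n (G.dist o v) with hlt | hle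
    · right
      have hv' : G.dist o v = n + 1 := le_antisymm hv hlt
      have hn := h n hlt.le
      refine Set.mem_biUnion (x := c n) (by simp [gball, hn]) ?_
      rw [hv'] at hc
      have h3 := hs n
      rw [hc] at h3
      have h4 : G.dist (c n) v ≠ 0 := fun h0 => by
        rw [hG.dist_eq_zero_iff] at h0
        rw [h0] at hn
        omega
      exact dist_eq_one_iff_adj.mp (by omega)
    · exact Or.inl hle

/-- An infinite connected locally finite graph has nonempty spheres. -/
lemma Connected.exists_dist_eq [Infinite V] (hG : G.Connected)
    (hlf : ∀ v, (G.neighborSet v).Finite) (o : V) (n : ℕ) : ∃ v, G.dist o v = n := by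
  obtain ⟨u, hu⟩ := (hG.finite_gball hlf o n).exists_notMem
  obtain ⟨c, -, -, -, h, -⟩ := hG.exists_geodesic o u
  exact ⟨c n, h n (not_le.mp hu).le⟩

end Distance

/-- `π` contracts `H` onto `G` with finite connected fibres. -/
structure IsContraction {W V : Type*} (H : SimpleGraph W) (G : SimpleGraph V) (π : W → V) :
    Prop where
  surjective : Function.Surjective π
  eq_or_adj : ∀ {a b}, H.Adj a b → π a = π b ∨ G.Adj (π a) (π b)
  exists_lift : ∀ {u v}, G.Adj u v → ∃ a b, π a = u ∧ π b = v ∧ H.Adj a b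
  reachable_fiber : ∀ a b (h : π a = π b),
    (H.induce (π ⁻¹' {π b})).Reachable ⟨a, h⟩ ⟨b, rfl⟩
  finite_fiber : ∀ v, (π ⁻¹' {v}).Finite

namespace IsContraction

variable {U W V : Type*} {I : SimpleGraph U} {H : SimpleGraph W} {G : SimpleGraph V}
  {π : W → V} {ρ : U → W}

lemma reachable_of_eq (hπ : IsContraction H G π) {S : Set V} {a b : W} (ha : π a ∈ S)
    (hb : π b ∈ S) (h : π a = π b) :
    (H.induce (π ⁻¹' S)).Reachable ⟨a, ha⟩ ⟨b, hb⟩ :=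
  (hπ.reachable_fiber a b h).map
    (induceHom (G := H) (G' := H) Hom.id (s := π ⁻¹' {π b}) (t := π ⁻¹' S) (by
      intro x hx
      have : π x = π b := hx
      simpa [this] using hb))

lemma reachable_iff (hπ : IsContraction H G π) {S : Set V} {a b : W} (ha : π a ∈ S)
    (hb : π b ∈ S) :
    (H.induce (π ⁻¹' S)).Reachable ⟨a, ha⟩ ⟨b, hb⟩ ↔
      (G.induce S).Reachable ⟨π a, ha⟩ ⟨π b, hb⟩ := by
  constructor
  · rintro ⟨p⟩
    suffices ∀ (x y : π ⁻¹' S), (H.induce (π ⁻¹' S)).Walk x y →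
        (G.induce S).Reachable ⟨π x, x.2⟩ ⟨π y, y.2⟩ from this _ _ p
    intro x y p
    induction p with
    | nil => exact Reachable.refl _
    | @cons u v w h p ih =>
      refine Reachable.trans ?_ ih
      rcases hπ.eq_or_adj (a := u.1) (b := v.1) h with e | e
      · simp [e]
      · exact Adj.reachable (by exact e)
  · rintro ⟨p⟩
    suffices ∀ (x y : S), (G.induce S).Walk x y → ∀ (a b : W) (ha : π a = x) (hb : π b = y),
        (H.induce (π ⁻¹' S)).Reachable ⟨a, by simp [ha]⟩ ⟨b, by simp [hb]⟩ from
      this _ _ p a b rfl rfl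
    intro x y p
    induction p with
    | nil => exact fun a b ha hb => hπ.reachable_of_eq _ _ (ha.trans hb.symm)
    | @cons u v w h p ih =>
      intro a b ha hb
      obtain ⟨c, d, hc, hd, hcd⟩ := hπ.exists_lift (u := u.1) (v := v.1) h
      refine (hπ.reachable_of_eq (b := c) _ (by simp [hc]) (ha.trans hc.symm)).trans ?_
      refine Reachable.trans (Adj.reachable ?_) (ih d b hd hb)
      exact hcd

lemma comp (hπ : IsContraction H G π) (hρ : IsContraction I H ρ) :
    IsContraction I G (π ∘ ρ) where
  surjective := hπ.surjective.comp hρ.surjective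
  eq_or_adj h := by
    rcases hρ.eq_or_adj h with e | e
    · exact Or.inl (congrArg π e)
    · exact hπ.eq_or_adj e
  exists_lift h := by
    obtain ⟨a, b, rfl, rfl, hab⟩ := hπ.exists_lift h
    obtain ⟨c, d, rfl, rfl, hcd⟩ := hρ.exists_lift hab
    exact ⟨c, d, rfl, rfl, hcd⟩
  reachable_fiber a b h :=
    (hρ.reachable_iff (S := π ⁻¹' {π (ρ b)}) (a := a) (b := b) h rfl).mpr
      (hπ.reachable_fiber _ _ h)
  finite_fiber v := by
    rw [Set.preimage_comp, ← Set.biUnion_preimage_singleton]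
    exact (hπ.finite_fiber v).biUnion fun w _ => hρ.finite_fiber w

lemma connected (hπ : IsContraction H G π) (hG : G.Connected) : H.Connected := by
  have : Nonempty W := by
    obtain ⟨v⟩ := hG.nonempty
    exact ⟨(hπ.surjective v).choose⟩
  refine ⟨fun a b => ?_⟩
  have h := (hπ.reachable_iff (S := Set.univ) (a := a) (b := b) trivial trivial).mpr
    ((hG.preconnected (π a) (π b)).map (induceUnivIso G).symm.toHom)
  exact h.map (Embedding.induce (G := H) _).toHom

lemma dist_map_le (hπ : IsContraction H G π) (hG : G.Connected) (a b : W) :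
    G.dist (π a) (π b) ≤ H.dist a b := by
  have := (hπ.connected hG).le_add_dist (fun x => (G.dist (π a) (π x) : ℤ)) (fun x y h => by
    rcases hπ.eq_or_adj h with e | e
    · simp [e]
    · have := hG.dist_triangle (u := π a) (v := π x) (w := π y)
      rw [dist_eq_one_iff_adj.mpr e] at this
      exact_mod_cast this) a b
  simpa using this

lemma dist_le_of_eq (hπ : IsContraction H G π) {K : ℕ}
    (hK : ∀ v, (π ⁻¹' {v}).ncard ≤ K) {a b : W} (h : π a = π b) : H.dist a b ≤ K := by
  classical
  have := (hπ.finite_fiber (π b)).fintype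
  obtain ⟨p, hp⟩ := (hπ.reachable_fiber a b h).exists_isPath
  have h1 := hp.length_lt
  have h2 := dist_le (p.map (Embedding.induce (G := H) _).toHom)
  rw [Walk.length_map] at h2
  have h3 := hK (π b)
  rw [Set.ncard_eq_toFinset_card', Set.toFinset_card] at h3
  exact h2.trans (h1.le.trans h3)

lemma dist_le_mul (hπ : IsContraction H G π) (hG : G.Connected) {K : ℕ}
    (hK : ∀ v, (π ⁻¹' {v}).ncard ≤ K) (a b : W) :
    H.dist a b ≤ (K + 1) * G.dist (π a) (π b) + K := by
  obtain ⟨p, hp⟩ := hG.exists_walk_length_eq_dist (π a) (π b)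
  rw [← hp]
  clear hp
  suffices ∀ u v (p : G.Walk u v) (a b : W), π a = u → π b = v →
      H.dist a b ≤ (K + 1) * p.length + K from this _ _ p a b rfl rfl
  intro u v p
  induction p with
  | nil => exact fun a b ha hb => by simpa using hπ.dist_le_of_eq hK (ha.trans hb.symm)
  | @cons u v w h p ih =>
    intro a b ha hb
    obtain ⟨c, d, hc, hd, hcd⟩ := hπ.exists_lift h
    have hH := hπ.connected hG
    have h1 := hπ.dist_le_of_eq hK (ha.trans hc.symm)
    have h2 := ih d b hd hb
    have h3 := dist_eq_one_iff_adj.mpr hcd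
    have h4 := hH.dist_triangle (u := a) (v := c) (w := b)
    have h5 := hH.dist_triangle (u := c) (v := d) (w := b)
    rw [Walk.length_cons]
    nlinarith

lemma finite_preimage (hπ : IsContraction H G π) {S : Set V} (hS : S.Finite) :
    (π ⁻¹' S).Finite := by
  rw [← Set.biUnion_preimage_singleton]
  exact hS.biUnion fun v _ => hπ.finite_fiber v

section Ends

open CategoryTheory Opposite

/-- The preimage of a finite vertex set under a contraction. -/
noncomputable def preimage (hπ : IsContraction H G π) (K : Finset V) : Finset W :=
  (hπ.finite_preimage K.finite_toSet).toFinset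

lemma mem_preimage (hπ : IsContraction H G π) {K : Finset V} {a : W} :
    a ∈ hπ.preimage K ↔ π a ∈ K := by
  simp [preimage]

lemma coe_preimage (hπ : IsContraction H G π) (K : Finset V) :
    (↑(hπ.preimage K) : Set W)ᶜ = π ⁻¹' (↑K : Set V)ᶜ := by
  ext a
  simp [mem_preimage]

lemma componentComplMk_eq_iff (hπ : IsContraction H G π) {K : Finset V} {a b : W}
    (ha : a ∉ (hπ.preimage K : Set W)) (hb : b ∉ (hπ.preimage K : Set W))
    (ha' : π a ∉ (K : Set V)) (hb' : π b ∉ (K : Set V)) :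
    H.componentComplMk ha = H.componentComplMk hb ↔
      G.componentComplMk ha' = G.componentComplMk hb' := by
  rw [ConnectedComponent.eq, ConnectedComponent.eq,
    ← hπ.reachable_iff (S := (↑K : Set V)ᶜ) (a := a) (b := b) ha' hb']
  have key : ∀ (S T : Set W) (hST : S = T) (h1 : a ∈ S) (h2 : b ∈ S) (h1' : a ∈ T) (h2' : b ∈ T),
      (H.induce S).Reachable ⟨a, h1⟩ ⟨b, h2⟩ ↔ (H.induce T).Reachable ⟨a, h1'⟩ ⟨b, h2'⟩ := by
    rintro S _ rfl _ _ _ _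
    rfl
  exact key _ _ (hπ.coe_preimage K) _ _ _ _

/-- The map induced on components outside a finite set. -/
noncomputable def componentMap (hπ : IsContraction H G π) (K : Finset V) :
    H.ComponentCompl (hπ.preimage K : Set W) → G.ComponentCompl (K : Set V) :=
  ComponentCompl.lift
    (fun a ha => G.componentComplMk (v := π a) (K := (K : Set V))
      (by simpa [mem_preimage] using ha))
    (fun _ _ ha hb h => (hπ.componentComplMk_eq_iff ha hb _ _).mp
      (H.componentComplMk_eq_of_adj ha hb h))

lemma componentMap_bijective (hπ : IsContraction H G π) (K : Finset V) :
    Function.Bijective (hπ.componentMap K) := by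
  constructor
  · refine ComponentCompl.ind fun a ha => ComponentCompl.ind fun b hb h => ?_
    exact (hπ.componentComplMk_eq_iff ha hb _ _).mpr h
  · refine ComponentCompl.ind fun v hv => ?_
    obtain ⟨a, rfl⟩ := hπ.surjective v
    exact ⟨H.componentComplMk (v := a) (by simpa [mem_preimage] using hv), rfl⟩

lemma preimage_mono (hπ : IsContraction H G π) {K L : Finset V} (h : K ⊆ L) :
    hπ.preimage K ⊆ hπ.preimage L := fun _ ha =>
  hπ.mem_preimage.mpr (h (hπ.mem_preimage.mp ha))

lemma componentMap_hom (hπ : IsContraction H G π) {K L : Finset V} (h : (K : Set V) ⊆ L)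
    (h' : (hπ.preimage K : Set W) ⊆ hπ.preimage L)
    (C : H.ComponentCompl (hπ.preimage L : Set W)) :
    hπ.componentMap K (C.hom h') = (hπ.componentMap L C).hom h := by
  induction C using ComponentCompl.ind with
  | f _ => rfl

/-- A contraction with finite connected fibres preserves the number of ends. -/
theorem mk_end_eq {W V : Type} {H : SimpleGraph W} {G : SimpleGraph V} {π : W → V}
    (hπ : IsContraction H G π) : Cardinal.mk ↥(H.end) = Cardinal.mk ↥(G.end) := by
  classical
  have hom_end : ∀ {V : Type} {G : SimpleGraph V} (e : ↥G.end) {K L : Finset V}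
      (h : (K : Set V) ⊆ L), ComponentCompl.hom h (e.1 (op L)) = e.1 (op K) :=
    fun e K L h => e.2 (opHomOfLE (Finset.coe_subset.mp h) : op L ⟶ op K)
  have sub_pre : ∀ K : Finset W, (K : Set W) ⊆ hπ.preimage (K.image π) := fun K a ha => by
    simp only [Finset.mem_coe, mem_preimage] at ha ⊢
    exact Finset.mem_image_of_mem π ha
  refine Cardinal.mk_congr (Equiv.ofBijective
    (fun e => ⟨fun K => hπ.componentMap K.unop (e.1 (op (hπ.preimage K.unop))), ?_⟩) ⟨?_, ?_⟩)
  · intro L K f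
    have h : (K.unop : Set V) ⊆ L.unop := Finset.coe_subset.mpr (leOfHom f.unop)
    have h' := Finset.coe_subset.mpr (hπ.preimage_mono (Finset.coe_subset.mp h))
    exact (hπ.componentMap_hom h h' _).symm.trans (congrArg _ (hom_end e h'))
  · intro e e' h
    apply Subtype.ext
    funext K
    induction K using Opposite.rec with
    | op K =>
    have h1 := congrFun (congrArg Subtype.val h) (op (K.image π))
    have h2 := (hπ.componentMap_bijective _).1 h1
    change e.1 (op K) = e'.1 (op K)
    rw [← hom_end e (sub_pre K), ← hom_end e' (sub_pre K)]
    exact congrArg _ h2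
  · intro ε
    choose lift hlift using fun K : Finset V => (hπ.componentMap_bijective K).2 (ε.1 (op K))
    have lift_hom : ∀ {K L : Finset V} (h' : (hπ.preimage K : Set W) ⊆ hπ.preimage L),
        K ⊆ L → ComponentCompl.hom h' (lift L) = lift K := fun {K L} h' h => by
      apply (hπ.componentMap_bijective K).1
      rw [hπ.componentMap_hom (Finset.coe_subset.mpr h) h', hlift, hlift, hom_end ε]
    refine ⟨⟨fun K => ComponentCompl.hom (sub_pre K.unop) (lift (K.unop.image π)), ?_⟩, ?_⟩
    · intro L K f
      have h : (K.unop : Set W) ⊆ L.unop := Finset.coe_subset.mpr (leOfHom f.unop)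
      have h1 := Finset.image_subset_image (f := π) (Finset.coe_subset.mp h)
      have h2 := Finset.coe_subset.mpr (hπ.preimage_mono h1)
      change ComponentCompl.hom h (ComponentCompl.hom (sub_pre L.unop) _) =
        ComponentCompl.hom (sub_pre K.unop) _
      rw [← lift_hom h2 h1, ← ComponentCompl.hom_trans, ← ComponentCompl.hom_trans]
    · apply Subtype.ext
      funext K
      induction K using Opposite.rec with
      | op K =>
      change hπ.componentMap K (ComponentCompl.hom (sub_pre _) (lift _)) = _
      have h1 : (hπ.preimage K).image π ⊆ K := by
        intro v hv
        obtain ⟨a, ha, rfl⟩ := Finset.mem_image.mp hv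
        exact hπ.mem_preimage.mp ha
      have h2 := Finset.coe_subset.mpr (hπ.preimage_mono h1)
      rw [← lift_hom h2 h1, ← ComponentCompl.hom_trans, ComponentCompl.hom_refl, hlift]

end Ends

end IsContraction

section Cubic

variable {U : Type*}

/-- Every vertex `y` of `Y` is replaced by two cycles of length `n + 3`; an edge `yz` joins
position `e y z` of the cycles at `y` to position `e z y` of the cycles at `z`, and the positions
at `y` which are not used by edges join the two cycles at `y`. -/
def cubic (Y : SimpleGraph U) (n : ℕ) (e : U → U → ZMod (n + 3)) :
    SimpleGraph (U × ZMod (n + 3) × Bool) where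
  Adj p q :=
    (p.1 = q.1 ∧ p.2.2 = q.2.2 ∧ (q.2.1 = p.2.1 + 1 ∨ p.2.1 = q.2.1 + 1)) ∨
    (Y.Adj p.1 q.1 ∧ p.2.2 = q.2.2 ∧ e p.1 q.1 = p.2.1 ∧ e q.1 p.1 = q.2.1) ∨
    (p.1 = q.1 ∧ p.2.1 = q.2.1 ∧ p.2.2 ≠ q.2.2 ∧ ∀ z, Y.Adj p.1 z → e p.1 z ≠ p.2.1)
  symm := ⟨by
    rintro ⟨y, i, b⟩ ⟨z, j, c⟩ h
    dsimp only at h ⊢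
    rcases h with ⟨rfl, rfl, h⟩ | ⟨h, rfl, h1, h2⟩ | ⟨rfl, rfl, h1, h2⟩
    · exact Or.inl ⟨rfl, rfl, h.symm⟩
    · exact Or.inr (Or.inl ⟨h.symm, rfl, h2, h1⟩)
    · exact Or.inr (Or.inr ⟨rfl, rfl, h1.symm, h2⟩)⟩
  loopless := ⟨by
    have : Fact (1 < n + 3) := ⟨by omega⟩
    rintro ⟨y, i, b⟩ h
    simp at h⟩

variable {Y : SimpleGraph U} {n : ℕ} {e : U → U → ZMod (n + 3)}

lemma isContraction_cubic (he : ∀ y z, Y.Adj y z → e y z ≠ 0) :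
    IsContraction (cubic Y n e) Y Prod.fst where
  surjective y := ⟨(y, 0, false), rfl⟩
  eq_or_adj := by
    rintro a b (h | h | h)
    · exact Or.inl h.1
    · exact Or.inr h.1
    · exact Or.inl h.1
  exists_lift {u v} h := ⟨(u, e u v, false), (v, e v u, false), rfl, rfl,
    Or.inr (Or.inl ⟨h, rfl, rfl, rfl⟩)⟩
  reachable_fiber := by
    rintro ⟨y, i, b⟩ ⟨z, j, c⟩ h
    obtain rfl : y = z := h
    have cyc : ∀ (k : ℕ) (b : Bool), ((cubic Y n e).induce (Prod.fst ⁻¹' {y})).Reachable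
        ⟨(y, 0, b), rfl⟩ ⟨(y, (k : ZMod (n + 3)), b), rfl⟩ := fun k b => by
      induction k with
      | zero => simp
      | succ k ih =>
        refine ih.trans (Adj.reachable ?_)
        exact Or.inl ⟨rfl, rfl, Or.inl (by push_cast; rfl)⟩
    have cyc' : ∀ (i : ZMod (n + 3)) (b : Bool),
        ((cubic Y n e).induce (Prod.fst ⁻¹' {y})).Reachable
        ⟨(y, 0, b), rfl⟩ ⟨(y, i, b), rfl⟩ := fun i b => by
      simpa using cyc i.val b
    have cross : ∀ b c : Bool, ((cubic Y n e).induce (Prod.fst ⁻¹' {y})).Reachable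
        ⟨(y, 0, b), rfl⟩ ⟨(y, 0, c), rfl⟩ := fun b c => by
      rcases eq_or_ne b c with rfl | hbc
      · rfl
      · exact Adj.reachable (Or.inr (Or.inr ⟨rfl, rfl, hbc, he y⟩))
    exact (cyc' i b).symm.trans ((cross b c).trans (cyc' j c))
  finite_fiber v := by
    refine ((Set.finite_singleton v).prod
      (Set.finite_univ (α := ZMod (n + 3) × Bool))).subset ?_
    rintro ⟨y, x⟩ hy
    exact ⟨hy, trivial⟩

lemma ncard_fiber_cubic (y : U) :
    (Prod.fst ⁻¹' {y} : Set (U × ZMod (n + 3) × Bool)).ncard = (n + 3) * 2 := by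
  have : (Prod.fst ⁻¹' {y} : Set (U × ZMod (n + 3) × Bool)) = {y} ×ˢ Set.univ := by
    ext ⟨a, b⟩
    simp
  rw [this, Set.ncard_prod, Set.ncard_univ]
  simp

lemma ncard_neighborSet_cubic (he : ∀ y, Set.InjOn (e y) (Y.neighborSet y))
    (w : U × ZMod (n + 3) × Bool) : ((cubic Y n e).neighborSet w).ncard = 3 := by
  obtain ⟨y, i, b⟩ := w
  have : Fact (1 < n + 3) := ⟨by omega⟩
  have hne : i + 1 ≠ i - 1 := fun h => by
    have h2 : ((2 : ℕ) : ZMod (n + 3)) = 0 := by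
      have : i + 1 - (i - 1) = 0 := sub_eq_zero.mpr h
      ring_nf at this
      exact_mod_cast this
    rw [ZMod.natCast_eq_zero_iff] at h2
    exact absurd (Nat.le_of_dvd (by norm_num) h2) (by omega)
  have hsub : ∀ j : ZMod (n + 3), (j = i + 1 ∨ i = j + 1) ↔ (j = i + 1 ∨ j = i - 1) :=
    fun j => or_congr_right ⟨fun h => by rw [h]; ring, fun h => by rw [h]; ring⟩
  rw [Set.ncard_eq_three]
  by_cases h : ∃ z, Y.Adj y z ∧ e y z = i
  · obtain ⟨z, hz, hi⟩ := h
    refine ⟨(y, i + 1, b), (y, i - 1, b), (z, e z y, b), by simp [hne], ?_, ?_, ?_⟩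
    · simp [hz.ne]
    · simp [hz.ne]
    · ext ⟨u, j, c⟩
      simp only [mem_neighborSet, cubic, hsub, Set.mem_insert_iff, Set.mem_singleton_iff,
        Prod.mk.injEq]
      constructor
      · rintro (⟨rfl, rfl, h⟩ | ⟨h, rfl, h1, rfl⟩ | ⟨rfl, rfl, -, h⟩)
        · simpa [hz.ne] using h
        · obtain rfl := he y h hz (h1.trans hi.symm)
          simp
        · exact absurd hi (h z hz)
      · rintro (⟨rfl, rfl, rfl⟩ | ⟨rfl, rfl, rfl⟩ | ⟨rfl, rfl, rfl⟩)
        · simp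
        · simp
        · exact Or.inr (Or.inl ⟨hz, rfl, hi, rfl⟩)
  · push Not at h
    refine ⟨(y, i + 1, b), (y, i - 1, b), (y, i, !b), by simp [hne], ?_, ?_, ?_⟩
    · simp
    · simp
    · ext ⟨u, j, c⟩
      simp only [mem_neighborSet, cubic, hsub, Set.mem_insert_iff, Set.mem_singleton_iff,
        Prod.mk.injEq]
      constructor
      · rintro (⟨rfl, rfl, h⟩ | ⟨h', rfl, h1, rfl⟩ | ⟨rfl, rfl, h', -⟩)
        · simpa using h
        · exact absurd h1 (h u h')
        · refine Or.inr (Or.inr ⟨rfl, rfl, ?_⟩)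
          cases b <;> cases c <;> simp_all
      · rintro (⟨rfl, rfl, rfl⟩ | ⟨rfl, rfl, rfl⟩ | ⟨rfl, rfl, rfl⟩)
        · simp
        · simp
        · exact Or.inr (Or.inr ⟨rfl, rfl, by simp, h⟩)

/-- In a graph of bounded degree one can choose, at every vertex, distinct nonzero positions
for the edges. -/
lemma exists_positions (hfin : ∀ y, (Y.neighborSet y).Finite)
    (hn : ∀ y, (Y.neighborSet y).ncard ≤ n) :
    ∃ e : U → U → ZMod (n + 3), (∀ y z, Y.Adj y z → e y z ≠ 0) ∧
      ∀ y, Set.InjOn (e y) (Y.neighborSet y) := by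
  have key : ∀ y, ∃ f : U → ZMod (n + 3), (∀ z, Y.Adj y z → f z ≠ 0) ∧
      Set.InjOn f (Y.neighborSet y) := fun y => by
    have hcard : (Y.neighborSet y).encard ≤ ({0}ᶜ : Set (ZMod (n + 3))).encard := by
      rw [← (hfin y).cast_ncard_eq, ← (Set.toFinite _).cast_ncard_eq, Set.ncard_compl]
      have := hn y
      simp only [Nat.card_zmod, Set.ncard_singleton]
      exact_mod_cast (by omega)
    obtain ⟨f, hf, hinj⟩ := (hfin y).exists_injOn_of_encard_le hcard
    exact ⟨f, fun z hz => hf hz, hinj⟩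
  choose e he using key
  exact ⟨e, fun y => (he y).1, fun y => (he y).2⟩

end Cubic

section Comb

variable {V : Type*} {G : SimpleGraph V} {h : V → ℕ}

/-- The graph obtained from `G` by attaching a path of length `h v` to every vertex `v`. -/
def comb (G : SimpleGraph V) (h : V → ℕ) : SimpleGraph {p : V × ℕ // p.2 ≤ h p.1} where
  Adj a b := (G.Adj a.1.1 b.1.1 ∧ a.1.2 = 0 ∧ b.1.2 = 0) ∨
    (a.1.1 = b.1.1 ∧ (a.1.2 + 1 = b.1.2 ∨ b.1.2 + 1 = a.1.2))
  symm := ⟨fun a b hab => by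
    rcases hab with ⟨h1, h2, h3⟩ | ⟨h1, h2⟩
    · exact Or.inl ⟨h1.symm, h3, h2⟩
    · exact Or.inr ⟨h1.symm, h2.symm⟩⟩
  loopless := ⟨fun a ha => by simp at ha⟩

lemma isContraction_comb (G : SimpleGraph V) (h : V → ℕ) :
    IsContraction (comb G h) G (fun a => a.1.1) where
  surjective v := ⟨⟨(v, 0), Nat.zero_le _⟩, rfl⟩
  eq_or_adj := by
    rintro a b (h | h)
    · exact Or.inr h.1
    · exact Or.inl h.1
  exists_lift {u v} huv := ⟨⟨(u, 0), Nat.zero_le _⟩, ⟨(v, 0), Nat.zero_le _⟩, rfl, rfl,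
    Or.inl ⟨huv, rfl, rfl⟩⟩
  reachable_fiber := by
    rintro ⟨⟨v, k⟩, hk⟩ ⟨⟨u, l⟩, hl⟩ huv
    obtain rfl : v = u := huv
    have down : ∀ (k : ℕ) (hk : k ≤ h v),
        ((comb G h).induce ((fun a : {p : V × ℕ // p.2 ≤ h p.1} => a.1.1) ⁻¹' {v})).Reachable
        ⟨⟨(v, 0), Nat.zero_le _⟩, rfl⟩ ⟨⟨(v, k), hk⟩, rfl⟩ := fun k => by
      induction k with
      | zero => exact fun _ => Reachable.refl _
      | succ k ih =>
        exact fun hk => (ih (by omega)).trans (Adj.reachable (Or.inr ⟨rfl, Or.inl rfl⟩))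
    exact (down k hk).symm.trans (down l hl)
  finite_fiber v := by
    refine Set.Finite.of_finite_image (f := fun a => a.1.2)
      ((Set.finite_Iic (h v)).subset ?_) ?_
    · rintro _ ⟨⟨⟨u, k⟩, hk⟩, rfl, rfl⟩
      exact hk
    · rintro ⟨⟨u, k⟩, hk⟩ hu ⟨⟨w, l⟩, hl⟩ hw hkl
      obtain rfl : u = v := hu
      obtain rfl : w = u := hw
      simpa using hkl

lemma comb_connected (hG : G.Connected) (h : V → ℕ) : (comb G h).Connected :=
  (isContraction_comb G h).connected hG

lemma neighborSet_comb_subset (a : {p : V × ℕ // p.2 ≤ h p.1}) :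
    Subtype.val '' (comb G h).neighborSet a ⊆ (fun v => (v, 0)) '' G.neighborSet a.1.1 ∪
      {(a.1.1, a.1.2 + 1), (a.1.1, a.1.2 - 1)} := by
  rintro _ ⟨⟨⟨u, k⟩, hk⟩, (⟨h1, -, rfl⟩ | ⟨h1, h2⟩), rfl⟩
  · exact Or.inl ⟨u, h1, rfl⟩
  · right
    dsimp only at h1 h2
    rcases h2 with h2 | h2
    · exact Or.inl (by simp [h1, h2])
    · exact Or.inr (by simp [h1, ← h2])

lemma finite_neighborSet_comb (hlf : ∀ v, (G.neighborSet v).Finite)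
    (a : {p : V × ℕ // p.2 ≤ h p.1}) : ((comb G h).neighborSet a).Finite :=
  Set.Finite.of_finite_image ((((hlf _).image _).union (Set.toFinite _)).subset
    (neighborSet_comb_subset a)) Subtype.val_injective.injOn

lemma ncard_neighborSet_comb_le (hlf : ∀ v, (G.neighborSet v).Finite)
    (a : {p : V × ℕ // p.2 ≤ h p.1}) :
    ((comb G h).neighborSet a).ncard ≤ (G.neighborSet a.1.1).ncard + 2 := by
  rw [← Set.ncard_image_of_injective _ Subtype.val_injective]
  refine (Set.ncard_le_ncard (neighborSet_comb_subset a)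
    (((hlf _).image _).union (Set.toFinite _))).trans ((Set.ncard_union_le _ _).trans ?_)
  exact add_le_add (Set.ncard_image_le (hlf _)) ((Set.ncard_insert_le _ _).trans (by simp))

lemma dist_comb_base_le (hG : G.Connected) (u v : V) :
    (comb G h).dist ⟨(u, 0), Nat.zero_le _⟩ ⟨(v, 0), Nat.zero_le _⟩ ≤ G.dist u v :=
  Hom.dist_le hG (H := comb G h)
    ⟨fun v => ⟨(v, 0), Nat.zero_le _⟩, fun {_ _} huv => Or.inl ⟨huv, rfl, rfl⟩⟩ u v

lemma dist_comb_vertical_le (hG : G.Connected) {v : V} {k l : ℕ} (hl : k + l ≤ h v)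
    (hk : k ≤ h v) : (comb G h).dist ⟨(v, k), hk⟩ ⟨(v, k + l), hl⟩ ≤ l := by
  induction l with
  | zero => simp
  | succ l ih =>
    have hl' : k + l ≤ h v := by omega
    have h1 := (comb_connected hG h).dist_triangle (u := ⟨(v, k), hk⟩)
      (v := ⟨(v, k + l), hl'⟩) (w := ⟨(v, k + (l + 1)), hl⟩)
    have h2 : (comb G h).dist ⟨(v, k + l), hl'⟩ ⟨(v, k + (l + 1)), hl⟩ = 1 :=
      dist_eq_one_iff_adj.mpr (Or.inr ⟨rfl, Or.inl rfl⟩)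
    have h3 := ih hl'
    omega

lemma dist_comb_le (hG : G.Connected) {v u : V} {k : ℕ} (hk : k ≤ h v) :
    (comb G h).dist ⟨(u, 0), Nat.zero_le _⟩ ⟨(v, k), hk⟩ ≤ G.dist u v + k := by
  have h1 := (comb_connected hG h).dist_triangle (u := ⟨(u, 0), Nat.zero_le _⟩)
    (v := ⟨(v, 0), Nat.zero_le _⟩) (w := ⟨(v, k), hk⟩)
  have h2 := dist_comb_base_le (h := h) hG u v
  have h3 := dist_comb_vertical_le hG (h := h) (v := v) (k := 0) (l := k) (by omega) (by omega)
  simp only [zero_add] at h3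
  omega

/-- The height function of a vertex over the base graph is 1-Lipschitz. -/
lemma le_dist_comb (hG : G.Connected) {v u : V} {k : ℕ} (hk : k ≤ h v) :
    G.dist u v + k ≤ (comb G h).dist ⟨(u, 0), Nat.zero_le _⟩ ⟨(v, k), hk⟩ := by
  have := (comb_connected hG h).le_add_dist (fun a => (G.dist u a.1.1 + a.1.2 : ℤ)) (by
    rintro ⟨⟨a, i⟩, hi⟩ ⟨⟨b, j⟩, hj⟩ (⟨h1, h2, h3⟩ | ⟨h1, h2⟩)
    · have := hG.dist_triangle (u := u) (v := a) (w := b)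
      rw [dist_eq_one_iff_adj.mpr h1] at this
      dsimp only at h2 h3 ⊢
      omega
    · dsimp only at h1 h2 ⊢
      subst h1
      omega) ⟨(u, 0), Nat.zero_le _⟩ ⟨(v, k), hk⟩
  simp at this
  exact_mod_cast this

/-- The signed height along the path attached to `v`. -/
lemma signed_height_le (hG : G.Connected) (v : V) [DecidableEq V]
    (a b : {p : V × ℕ // p.2 ≤ h p.1}) :
    (if b.1.1 = v then (b.1.2 : ℤ) else -G.dist v b.1.1) ≤
      (if a.1.1 = v then (a.1.2 : ℤ) else -G.dist v a.1.1) + (comb G h).dist a b := by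
  refine (comb_connected hG h).le_add_dist
    (fun a => if a.1.1 = v then (a.1.2 : ℤ) else -G.dist v a.1.1) ?_ a b
  rintro ⟨⟨a, i⟩, hi⟩ ⟨⟨b, j⟩, hj⟩ (⟨h1, h2, h3⟩ | ⟨h1, h2⟩)
  · have h4 := hG.dist_triangle (u := v) (v := b) (w := a)
    rw [dist_eq_one_iff_adj.mpr h1.symm] at h4
    have h5 : ∀ x, G.dist v x = 0 ↔ v = x := fun x => hG.dist_eq_zero_iff
    have h6 := h5 b
    have h7 := h5 a
    dsimp only at h1 h2 h3 ⊢
    split_ifs with h8 h9 h9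
    · omega
    · subst h8
      simp at h4
      omega
    · omega
    · omega
  · dsimp only at h1 h2 ⊢
    subst h1
    split_ifs <;> omega

end Comb

section Midpoints

variable {V A B : Type*}

/-- `x` is the midpoint of a geodesic of length `2 * R`. -/
def IsMidpoint (G : SimpleGraph V) (R : ℕ) (x : V) : Prop :=
  ∃ y z, G.dist x y ≤ R ∧ G.dist x z ≤ R ∧ 2 * R ≤ G.dist y z

lemma isMidpoint_of_transitive {G : SimpleGraph V} [Infinite V]
    (hlf : ∀ v : V, (G.neighborSet v).Finite) (hG : G.Connected)
    (htrans : ∀ u v : V, ∃ φ : G ≃g G, φ u = v) (R : ℕ) (x : V) : IsMidpoint G R x := by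
  obtain ⟨u, hu⟩ := hG.exists_dist_eq hlf x (2 * R)
  obtain ⟨c, -, -, -, h1, h2⟩ := hG.exists_geodesic x u
  obtain ⟨φ, hφ⟩ := htrans (c R) x
  have h3 := h1 R (by omega)
  have h4 := h2 R (by omega)
  have h5 := Hom.dist_le hG φ.toHom (c R) x
  have h6 := Hom.dist_le hG φ.toHom (c R) u
  have h7 := Hom.dist_le hG φ.symm.toHom (φ x) (φ u)
  simp only [RelIso.coe_toRelEmbedding, RelEmbedding.coe_toRelHom, RelIso.symm_apply_apply,
    hφ] at h5 h6 h7
  rw [dist_comm] at h3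
  exact ⟨φ x, φ u, by omega, by omega, by omega⟩

lemma isMidpoint_comb {G : SimpleGraph V} (hG : G.Connected)
    (hmid : ∀ R x, IsMidpoint G R x) (hsph : ∀ v n, ∃ u, G.dist v u = n) {h : V → ℕ} {R : ℕ}
    {v : V} {k : ℕ} (hk : k ≤ h v) (hR : h v = 0 ∨ k + R ≤ h v) :
    IsMidpoint (comb G h) R ⟨(v, k), hk⟩ := by
  classical
  rcases hR with h0 | hR
  · obtain rfl : k = 0 := by omega
    obtain ⟨y, z, h1, h2, h3⟩ := hmid R v
    refine ⟨⟨(y, 0), Nat.zero_le _⟩, ⟨(z, 0), Nat.zero_le _⟩,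
      (dist_comb_base_le hG _ _).trans h1, (dist_comb_base_le hG _ _).trans h2, h3.trans ?_⟩
    exact (isContraction_comb G h).dist_map_le hG ⟨(y, 0), Nat.zero_le _⟩ ⟨(z, 0), Nat.zero_le _⟩
  · rcases le_total R k with hRk | hRk
    · obtain ⟨l, rfl⟩ := Nat.exists_eq_add_of_le hRk
      have hl : l ≤ h v := by omega
      have hl' : l + R ≤ h v := by omega
      refine ⟨⟨(v, R + l + R), hR⟩, ⟨(v, l), hl⟩, dist_comb_vertical_le hG hR hk, ?_, ?_⟩
      · rw [dist_comm]
        simpa only [add_comm] using dist_comb_vertical_le hG hl' hl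
      · have := signed_height_le hG v (h := h) ⟨(v, l), hl⟩ ⟨(v, R + l + R), hR⟩
        rw [dist_comm]
        simp only [if_true] at this
        omega
    · obtain ⟨u, hu⟩ := hsph v (R - k)
      refine ⟨⟨(v, k + R), hR⟩, ⟨(u, 0), Nat.zero_le _⟩, dist_comb_vertical_le hG hR hk, ?_, ?_⟩
      · have h1 := dist_comb_le hG (u := u) hk
        rw [dist_comm] at h1 hu
        omega
      · have := signed_height_le hG v (h := h) ⟨(u, 0), Nat.zero_le _⟩ ⟨(v, k + R), hR⟩
        rw [dist_comm]
        simp only [if_true] at this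
        split_ifs at this with huv
        · subst huv
          simp at hu
          omega
        · omega

/-- The ball of radius `r` about `t` looks like a segment with endpoint `t`. -/
def IsDeadEnd (G : SimpleGraph V) (r : ℕ) (t : V) : Prop :=
  ∀ a b, G.dist t a ≤ r → G.dist t b ≤ r →
    G.dist a b ≤ (G.dist t a - G.dist t b) + (G.dist t b - G.dist t a)

lemma isDeadEnd_comb {G : SimpleGraph V} (hG : G.Connected) {h : V → ℕ} {v : V} {r : ℕ}
    (hr : r < h v) : IsDeadEnd (comb G h) r ⟨(v, h v), le_rfl⟩ := by
  classical
  have key : ∀ w : {p : V × ℕ // p.2 ≤ h p.1}, (comb G h).dist ⟨(v, h v), le_rfl⟩ w ≤ r →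
      ∃ k, ∃ hk : k ≤ h v, w = ⟨(v, k), hk⟩ ∧
        (comb G h).dist ⟨(v, h v), le_rfl⟩ w = h v - k := by
    rintro ⟨⟨u, k⟩, hk⟩ hw
    have h1 := signed_height_le hG v (h := h) ⟨(u, k), hk⟩ ⟨(v, h v), le_rfl⟩
    rw [dist_comm (G := comb G h)] at h1
    simp only [if_true] at h1
    split_ifs at h1 with huv
    · subst huv
      obtain ⟨l, hl⟩ := Nat.exists_eq_add_of_le (show k ≤ h u from hk)
      refine ⟨k, hk, rfl, ?_⟩
      have h2 := dist_comb_vertical_le hG (h := h) (v := u) (l := l) (by omega) hk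
      simp only [← hl] at h2
      rw [dist_comm] at h2
      omega
    · omega
  intro a b ha hb
  obtain ⟨k, hk, rfl, h1⟩ := key a ha
  obtain ⟨l, hl, rfl, h2⟩ := key b hb
  rw [h1, h2]
  rcases le_total k l with hkl | hkl
  · obtain ⟨j, rfl⟩ := Nat.exists_eq_add_of_le hkl
    have := dist_comb_vertical_le hG hl hk
    omega
  · obtain ⟨j, rfl⟩ := Nat.exists_eq_add_of_le hkl
    have := dist_comb_vertical_le hG hk hl
    rw [dist_comm] at this
    omega

lemma exists_first_exit (s : ℕ → ℕ) {ρ m n : ℕ} (h0 : s 0 < ρ) (hn : ρ ≤ s n)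
    (hs : ∀ i, s (i + 1) ≤ s i + m) : ∃ i ≤ n, ρ ≤ s i ∧ s i ≤ ρ + m := by
  classical
  have hex : ∃ i, ρ ≤ s i := ⟨n, hn⟩
  refine ⟨Nat.find hex, Nat.find_min' hex hn, Nat.find_spec hex, ?_⟩
  obtain ⟨j, hj⟩ := Nat.exists_eq_succ_of_ne_zero (n := Nat.find hex) (fun h => by
    have := Nat.find_spec hex
    rw [h] at this
    omega)
  have := Nat.find_min hex (m := j) (by omega)
  have := hs j
  rw [hj]
  simp only [Nat.succ_eq_add_one]
  omega

/-- A quasi-isometric embedding cannot send the midpoint of a long geodesic near a dead end. -/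
lemma not_isMidpoint_of_isDeadEnd {GA : SimpleGraph A} {GB : SimpleGraph B}
    (hA : GA.Connected) (hB : GB.Connected) (F : A → B) {M r R ρ : ℕ} (hM : 1 ≤ M)
    (hup : ∀ x y, GB.dist (F x) (F y) ≤ M * GA.dist x y + M)
    (hlow : ∀ x y, GA.dist x y ≤ M * GB.dist (F x) (F y) + M)
    (hρ : ρ = M * (2 * M * M + M + 1) + 2 * M) (hR : R = M * (ρ + M) + M + 1)
    (hr : ρ + 2 * M ≤ r) {t : B} (ht : IsDeadEnd GB r t) {x : A} (hx : GB.dist t (F x) ≤ M) :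
    ¬ IsMidpoint GA R x := by
  rintro ⟨y, z, hy, hz, hyz⟩
  have hMρ : M < ρ := by
    have : 0 < M * (2 * M * M + M + 1) := Nat.mul_pos hM (Nat.succ_pos _)
    omega
  have key : ∀ y, GA.dist x y = R → ∃ a, ∃ i ≤ R, GA.dist x a = i ∧ GA.dist a y = R - i ∧
      ρ ≤ GB.dist t (F a) ∧ GB.dist t (F a) ≤ ρ + 2 * M := by
    intro y hy
    obtain ⟨c, h0, h1, h2, h3, h4⟩ := hA.exists_geodesic x y
    rw [hy] at h1 h3 h4
    obtain ⟨i, hi, h5, h6⟩ := exists_first_exit (fun i => GB.dist t (F (c i))) (ρ := ρ)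
      (m := 2 * M) (n := R) (by rw [h0]; omega) (by
        rw [h1]
        by_contra! hlt
        have h5 := hlow x y
        have h6 := hB.dist_triangle (u := F x) (v := t) (w := F y)
        rw [dist_comm (u := F x) (v := t)] at h6
        have h7 : M * GB.dist (F x) (F y) ≤ M * (ρ + M) := Nat.mul_le_mul_left _ (by omega)
        omega) (fun i => by
        have h5 := hup (c i) (c (i + 1))
        have h6 := hB.dist_triangle (u := t) (v := F (c i)) (w := F (c (i + 1)))
        have h7 : M * GA.dist (c i) (c (i + 1)) ≤ M * 1 := Nat.mul_le_mul_left _ (h2 i)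
        omega)
    exact ⟨c i, i, hi, h3 i hi, h4 i hi, h5, h6⟩
  have hyz' := hA.dist_triangle (u := y) (v := x) (w := z)
  rw [dist_comm (u := y) (v := x)] at hyz'
  obtain ⟨a, i, hi, ha, hay, ha1, ha2⟩ := key y (by omega)
  obtain ⟨b, j, hj, hb, hbz, hb1, hb2⟩ := key z (by omega)
  have h1 := ht (F a) (F b) (by omega) (by omega)
  have h2 : M * GB.dist (F a) (F b) ≤ M * (2 * M) := Nat.mul_le_mul_left _ (by omega)
  have h3 := hlow a b
  have h4 := hA.dist_triangle (u := y) (v := a) (w := z)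
  have h5 := hA.dist_triangle (u := a) (v := b) (w := z)
  rw [dist_comm (u := y) (v := a)] at h4
  have h6 := hup x a
  have h7 := hB.dist_triangle (u := t) (v := F x) (w := F a)
  have h8 : i ≤ M * (2 * M) + M := by omega
  rw [ha] at h6
  nlinarith

end Midpoints

section Hairs

/-- Positions of the attached paths, at rapidly increasing distances. -/
def sparse : ℕ → ℕ
  | 0 => 0
  | m + 1 => (m + 1) * (sparse m + m + 2)

lemma mul_le_sparse {a b : ℕ} (hab : a < b) : b * (sparse a + a + 1) ≤ sparse b := by
  induction b with
  | zero => omega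
  | succ b ih =>
    rw [sparse]
    refine Nat.mul_le_mul_left _ ?_
    rcases Nat.lt_succ_iff_lt_or_eq.mp hab with h | rfl
    · have h1 := ih h
      have h2 : 1 * (sparse a + a + 1) ≤ b * (sparse a + a + 1) :=
        Nat.mul_le_mul_right _ (by omega)
      omega
    · omega

lemma sparse_add_lt {a b : ℕ} (hab : a < b) : sparse a + a < sparse b := by
  have h1 := mul_le_sparse hab
  have h2 : 1 * (sparse a + a + 1) ≤ b * (sparse a + a + 1) :=
    Nat.mul_le_mul_right _ (by omega)
  omega

variable {V : Type*}

open Classical in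
/-- The lengths of the paths attached at the vertices `p m`, for `m ∈ S`. -/
noncomputable def hairs (p : ℕ → V) (S : Set ℕ) (v : V) : ℕ :=
  if h : ∃ m ∈ S, p m = v then h.choose else 0

lemma hairs_apply {p : ℕ → V} (hp : Function.Injective p) {S : Set ℕ} {m : ℕ} (hm : m ∈ S) :
    hairs p S (p m) = m := by
  have h : ∃ n ∈ S, p n = p m := ⟨m, hm, rfl⟩
  rw [hairs, dif_pos h]
  exact hp h.choose_spec.2

lemma exists_of_hairs_ne_zero {p : ℕ → V} {S : Set ℕ} {v : V} (hv : hairs p S v ≠ 0) :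
    ∃ m ∈ S, p m = v ∧ hairs p S v = m := by
  by_cases h : ∃ m ∈ S, p m = v
  · exact ⟨h.choose, h.choose_spec.1, h.choose_spec.2, by rw [hairs, dif_pos h]⟩
  · exact absurd (by rw [hairs, dif_neg h]) hv

variable {G : SimpleGraph V} {o : V} {p : ℕ → V}

lemma injective_of_dist_eq_sparse (hp : ∀ m, G.dist o (p m) = sparse m) :
    Function.Injective p := by
  intro a b hab
  have h : sparse a = sparse b := by rw [← hp, ← hp, hab]
  rcases lt_trichotomy a b with hlt | rfl | hlt
  · have := sparse_add_lt hlt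
    omega
  · rfl
  · have := sparse_add_lt hlt
    omega

/-- A quasi-isometry between graphs with attached paths matches the long paths. -/
lemma exists_bound_mem_of_qi (hG : G.Connected) (hmid : ∀ R x, IsMidpoint G R x)
    (hsph : ∀ v n, ∃ u, G.dist v u = n) (hp : ∀ m, G.dist o (p m) = sparse m) {S T : Set ℕ}
    (F : {a : V × ℕ // a.2 ≤ hairs p S a.1} → {a : V × ℕ // a.2 ≤ hairs p T a.1}) {M : ℕ}
    (hM : 1 ≤ M)
    (hup : ∀ x y, (comb G (hairs p T)).dist (F x) (F y) ≤
      M * (comb G (hairs p S)).dist x y + M)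
    (hlow : ∀ x y, (comb G (hairs p S)).dist x y ≤
      M * (comb G (hairs p T)).dist (F x) (F y) + M)
    (hsurj : ∀ y, ∃ x, (comb G (hairs p T)).dist y (F x) ≤ M) :
    ∃ n, ∀ m ∈ T, n ≤ m → m ∈ S := by
  have hinj := injective_of_dist_eq_sparse hp
  have hS := comb_connected hG (hairs p S)
  have hT := comb_connected hG (hairs p T)
  obtain ⟨ρ, hρ⟩ : ∃ ρ, ρ = M * (2 * M * M + M + 1) + 2 * M := ⟨_, rfl⟩
  obtain ⟨R, hR⟩ : ∃ R, R = M * (ρ + M) + M + 1 := ⟨_, rfl⟩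
  set oS : {a : V × ℕ // a.2 ≤ hairs p S a.1} := ⟨(o, 0), Nat.zero_le _⟩
  set oT : {a : V × ℕ // a.2 ≤ hairs p T a.1} := ⟨(o, 0), Nat.zero_le _⟩
  set D := (comb G (hairs p T)).dist oT (F oS) with hD
  set B := D + 3 * M + M * R + M * D + M * M + R with hB
  refine ⟨B + ρ + 2 * M + 1, fun m hm hmB => ?_⟩
  have hhm := hairs_apply hinj hm
  set t : {a : V × ℕ // a.2 ≤ hairs p T a.1} := ⟨(p m, hairs p T (p m)), le_rfl⟩ with ht
  obtain ⟨x, hx⟩ := hsurj t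
  have hnot := not_isMidpoint_of_isDeadEnd hS hT F hM hup hlow hρ hR le_rfl
    (isDeadEnd_comb hG (by omega)) hx
  obtain ⟨⟨v, k⟩, hk⟩ := x
  have h0 : ¬ (hairs p S v = 0 ∨ k + R ≤ hairs p S v) := fun h =>
    hnot (isMidpoint_comb hG hmid hsph hk h)
  push Not at h0
  obtain ⟨m', hm', rfl, hhm'⟩ := exists_of_hairs_ne_zero h0.1
  set x : {a : V × ℕ // a.2 ≤ hairs p S a.1} := ⟨(p m', k), hk⟩ with hxdef
  have hk' : k ≤ hairs p S (p m') := hk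
  have dx1 := dist_comb_le hG (u := o) hk'
  have dx2 := le_dist_comb hG (u := o) hk'
  have dt1 := dist_comb_le hG (u := o) (h := hairs p T) (v := p m) le_rfl
  have dt2 := le_dist_comb hG (u := o) (h := hairs p T) (v := p m) le_rfl
  rw [hp] at dx1 dx2 dt1 dt2
  change (comb G (hairs p S)).dist oS x ≤ _ at dx1
  change _ ≤ (comb G (hairs p S)).dist oS x at dx2
  change (comb G (hairs p T)).dist oT t ≤ _ at dt1
  change _ ≤ (comb G (hairs p T)).dist oT t at dt2
  have e1 := hT.dist_triangle (u := oT) (v := F oS) (w := t)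
  have e2 := hT.dist_triangle (u := F oS) (v := F x) (w := t)
  have e3 := hT.dist_triangle (u := F oS) (v := oT) (w := F x)
  have e4 := hT.dist_triangle (u := oT) (v := t) (w := F x)
  rw [dist_comm (u := F x)] at e2
  rw [dist_comm (u := F oS) (v := oT)] at e3
  have e5 := hup oS x
  have e6 := hlow oS x
  have b1 : sparse m + m ≤ B * (sparse m' + m' + 1) := by
    have : M * (comb G (hairs p S)).dist oS x ≤ M * (sparse m' + m') :=
      Nat.mul_le_mul_left _ (by omega)
    have : M * (sparse m' + m') ≤ B * (sparse m' + m') := Nat.mul_le_mul_right _ (by omega)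
    rw [mul_add B]
    omega
  have b2 : sparse m' + m' ≤ B * (sparse m + m + 1) := by
    have : M * (comb G (hairs p T)).dist (F oS) (F x) ≤ M * (D + (sparse m + m) + M) :=
      Nat.mul_le_mul_left _ (by omega)
    have : M * (D + (sparse m + m) + M) = M * D + M * (sparse m + m) + M * M := by ring
    have : M * (sparse m + m) ≤ B * (sparse m + m) := Nat.mul_le_mul_right _ (by omega)
    rw [mul_add B]
    omega
  rcases lt_trichotomy m m' with hlt | rfl | hlt
  · have h1 := mul_le_sparse hlt
    have h2 : (B + 1) * (sparse m + m + 1) ≤ m' * (sparse m + m + 1) :=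
      Nat.mul_le_mul_right _ (by omega)
    rw [add_mul] at h2
    omega
  · exact hm'
  · have h1 := mul_le_sparse hlt
    have h2 : (B + 1) * (sparse m' + m' + 1) ≤ m * (sparse m' + m' + 1) :=
      Nat.mul_le_mul_right _ (by omega)
    rw [add_mul] at h2
    omega

/-- Attaching sparse paths at most doubles the size of balls. -/
lemma ncard_gball_comb_le (hG : G.Connected) (hlf : ∀ v, (G.neighborSet v).Finite)
    {γ : ℕ → V} (hγ : ∀ n, G.dist o (γ n) = n) (S : Set ℕ) (n : ℕ) :
    (gball (comb G (hairs (fun m => γ (sparse m)) S)) ⟨(o, 0), Nat.zero_le _⟩ n).ncard ≤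
      2 * (gball G o n).ncard := by
  classical
  set h := hairs (fun m => γ (sparse m)) S
  have hcard : (gball G o n ×ˢ (Set.univ : Set Bool)).ncard = 2 * (gball G o n).ncard := by
    rw [Set.ncard_prod, Set.ncard_univ]
    simp [mul_comm]
  rw [← hcard]
  refine Set.ncard_le_ncard_of_injOn
    (fun a => if a.1.2 = 0 then (a.1.1, true) else (γ (G.dist o a.1.1 + a.1.2), false)) ?_ ?_
    ((hG.finite_gball hlf o n).prod Set.finite_univ)
  · rintro ⟨⟨v, k⟩, hk⟩ ha
    have h1 := (le_dist_comb hG (u := o) (show k ≤ h v from hk)).trans ha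
    refine ⟨?_, trivial⟩
    dsimp only
    split_ifs
    · exact (Nat.le_add_right _ _).trans h1
    · exact (hγ _).trans_le h1
  · rintro ⟨⟨v, k⟩, hk⟩ - ⟨⟨u, l⟩, hl⟩ - hab
    dsimp only at hab hk hl
    split_ifs at hab with h1 h2 h2
    · simp only [Prod.mk.injEq, and_true] at hab
      subst h1 h2 hab
      rfl
    · simp at hab
    · simp at hab
    · have h3 : G.dist o v + k = G.dist o u + l := by
        rw [← hγ (G.dist o v + k), (Prod.mk.inj hab).1, hγ]
      obtain ⟨m, -, rfl, hm⟩ := exists_of_hairs_ne_zero (v := v)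
        (p := fun m => γ (sparse m)) (S := S) (show h v ≠ 0 by omega)
      obtain ⟨m', -, rfl, hm'⟩ := exists_of_hairs_ne_zero (v := u)
        (p := fun m => γ (sparse m)) (S := S) (show h u ≠ 0 by omega)
      change h _ = m at hm
      change h _ = m' at hm'
      rw [hγ, hγ] at h3
      rcases lt_trichotomy m m' with hlt | rfl | hlt
      · have := sparse_add_lt hlt
        omega
      · obtain rfl : k = l := by omega
        rfl
      · have := sparse_add_lt hlt
        omega

end Hairs

section Transfer

variable {W V W' V' : Type*} {H : SimpleGraph W} {G : SimpleGraph V} {H' : SimpleGraph W'}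
  {G' : SimpleGraph V'} {π' : W' → V'} {π : W → V}

/-- A quasi-isometry between two graphs induces one, with natural constants, between any graphs
onto which they contract with bounded fibres. -/
lemma IsContraction.exists_qi (hπ : IsContraction H G π) (hπ' : IsContraction H' G' π')
    (hG : G.Connected) (hG' : G'.Connected) {K : ℕ} (hK : ∀ v, (π ⁻¹' {v}).ncard ≤ K)
    (hK' : ∀ v, (π' ⁻¹' {v}).ncard ≤ K) {L A : ℝ} {f : W → W'} (hL : 1 ≤ L) (hA : 0 ≤ A)
    (hf : IsQIE (gdist H) (gdist H') L A f) (hs : IsCoarselySurj (gdist H') f) :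
    ∃ (F : V → V') (M : ℕ), 1 ≤ M ∧
      (∀ x y, G'.dist (F x) (F y) ≤ M * G.dist x y + M) ∧
      (∀ x y, G.dist x y ≤ M * G'.dist (F x) (F y) + M) ∧
      ∀ y, ∃ x, G'.dist y (F x) ≤ M := by
  obtain ⟨C, hC, hs⟩ := hs
  choose s hsec using hπ.surjective
  obtain ⟨M, hM⟩ := exists_nat_ge (L * (K + 1) + (L * K + A) + L * (K + A) + C + 1)
  have hLK : 0 ≤ L * K := by positivity
  have hLK1 : 0 ≤ L * (K + 1) := by positivity
  have hLKA : 0 ≤ L * (K + A) := by positivity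
  have hLA : 0 ≤ L * A := by positivity
  refine ⟨fun x => π' (f (s x)), M, ?_, fun x y => ?_, fun x y => ?_, fun y => ?_⟩
  · exact_mod_cast (by linarith : (1 : ℝ) ≤ M)
  · have h1 : ((G'.dist (π' (f (s x))) (π' (f (s y))) : ℕ) : ℝ) ≤ H'.dist (f (s x)) (f (s y)) :=
      Nat.cast_le.mpr (hπ'.dist_map_le hG' _ _)
    have h2 : ((H.dist (s x) (s y) : ℕ) : ℝ) ≤ (K + 1) * G.dist x y + K := by
      have := hπ.dist_le_mul hG hK (s x) (s y)
      rw [hsec, hsec] at this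
      exact_mod_cast this
    have h3 := (hf (s x) (s y)).2
    simp only [gdist] at h3
    have h4 : L * (H.dist (s x) (s y) : ℝ) ≤ L * ((K + 1) * G.dist x y + K) := by gcongr
    have h5 : L * (K + 1) * (G.dist x y : ℝ) ≤ M * G.dist x y := by
      gcongr
      linarith
    have h6 : (G'.dist (π' (f (s x))) (π' (f (s y))) : ℝ) ≤ M * G.dist x y + M := by linarith
    exact_mod_cast h6
  · have h1 : (G.dist x y : ℝ) ≤ H.dist (s x) (s y) := by
      have := hπ.dist_map_le hG (s x) (s y)
      rw [hsec, hsec] at this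
      exact_mod_cast this
    have h2 : (H'.dist (f (s x)) (f (s y)) : ℝ) ≤
        (K + 1) * G'.dist (π' (f (s x))) (π' (f (s y))) + K := by
      exact_mod_cast hπ'.dist_le_mul hG' hK' (f (s x)) (f (s y))
    have h3 := (hf (s x) (s y)).1
    simp only [gdist] at h3
    have h4 : (H.dist (s x) (s y) : ℝ) ≤ L * (H'.dist (f (s x)) (f (s y)) + A) := by
      have : L * ((1 / L) * (H.dist (s x) (s y) : ℝ)) ≤ L * (H'.dist (f (s x)) (f (s y)) + A) := by
        gcongr
        linarith
      rwa [← mul_assoc, mul_one_div_cancel (by linarith), one_mul] at this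
    have h5 : L * ((H'.dist (f (s x)) (f (s y)) : ℝ) + A) ≤
        L * ((K + 1) * G'.dist (π' (f (s x))) (π' (f (s y))) + K + A) := by gcongr
    have h6 : L * (K + 1) * (G'.dist (π' (f (s x))) (π' (f (s y))) : ℝ) ≤
        M * G'.dist (π' (f (s x))) (π' (f (s y))) := by
      gcongr
      linarith
    have h7 : (G.dist x y : ℝ) ≤ M * G'.dist (π' (f (s x))) (π' (f (s y))) + M := by linarith
    exact_mod_cast h7
  · obtain ⟨b, rfl⟩ := hπ'.surjective y
    obtain ⟨a, ha⟩ := hs b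
    refine ⟨π a, ?_⟩
    have h1 : (H.dist a (s (π a)) : ℝ) ≤ K := by
      exact_mod_cast hπ.dist_le_of_eq hK (hsec (π a)).symm
    have h2 := (hf a (s (π a))).2
    simp only [gdist] at h2 ha
    have h3 : L * (H.dist a (s (π a)) : ℝ) ≤ L * K := by gcongr
    have h4 : (G'.dist (π' b) (π' (f (s (π a)))) : ℝ) ≤ H'.dist b (f (s (π a))) :=
      Nat.cast_le.mpr (hπ'.dist_map_le hG' _ _)
    have h5 : (H'.dist b (f (s (π a))) : ℝ) ≤ H'.dist b (f a) + H'.dist (f a) (f (s (π a))) := by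
      exact_mod_cast (hπ'.connected hG').dist_triangle
    have h6 : (G'.dist (π' b) (π' (f (s (π a)))) : ℝ) ≤ M := by linarith
    exact_mod_cast h6

lemma IsContraction.ncard_gball_le (hπ : IsContraction H G π) (hG : G.Connected)
    (hlf : ∀ v, (G.neighborSet v).Finite) {K : ℕ} (hK : ∀ v, (π ⁻¹' {v}).ncard ≤ K)
    (w : W) (n : ℕ) : (gball H w n).ncard ≤ K * (gball G (π w) n).ncard := by
  classical
  have hfin := hG.finite_gball hlf (π w) n
  have hsub : gball H w n ⊆ π ⁻¹' gball G (π w) n := fun a ha =>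
    (hπ.dist_map_le hG w a).trans ha
  have hfin' := hπ.finite_preimage hfin
  refine (Set.ncard_le_ncard hsub hfin').trans ?_
  rw [Set.ncard_eq_toFinset_card _ hfin', Set.ncard_eq_toFinset_card _ hfin]
  refine Finset.card_le_mul_card_image_of_maps_to (f := π) (fun a ha => by simpa using ha) K
    fun v _ => ?_
  refine le_trans ?_ (hK v)
  rw [← Set.ncard_coe_finset]
  refine Set.ncard_le_ncard (fun a ha => ?_) (hπ.finite_fiber v)
  exact (Finset.mem_filter.mp (Finset.mem_coe.mp ha)).2

end Transfer

/-- Almost disjoint sets of natural numbers, coding the dyadic approximations of `α`. -/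
noncomputable def dyadicCode (α : ℝ) : Set ℕ :=
  Set.range fun k : ℕ => Nat.pair k ⌊2 ^ k * α⌋₊

lemma exists_mem_dyadicCode_notMem {α β : ℝ} (hα : 0 ≤ α) (hβ : 0 ≤ β) (hne : α ≠ β) (n : ℕ) :
    ∃ m ∈ dyadicCode β, n ≤ m ∧ m ∉ dyadicCode α := by
  obtain ⟨k, hk⟩ := pow_unbounded_of_one_lt (1 / |α - β|) (one_lt_two (α := ℝ))
  have hpos : 0 < |α - β| := abs_pos.mpr (sub_ne_zero.mpr hne)
  set j := max k n
  refine ⟨_, ⟨j, rfl⟩, (le_max_right k n).trans (Nat.left_le_pair _ _), ?_⟩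
  rintro ⟨i, hi⟩
  obtain ⟨hij, hfl⟩ := Nat.pair_eq_pair.mp hi
  rw [hij] at hfl
  have h1 : (2 : ℝ) ^ k ≤ 2 ^ j := pow_le_pow_right₀ (by norm_num) (le_max_left k n)
  have h2 : 1 < 2 ^ j * |α - β| := by
    rw [div_lt_iff₀ hpos] at hk
    exact hk.trans_le (by gcongr)
  have ha1 := Nat.floor_le (a := 2 ^ j * α) (by positivity)
  have ha2 := Nat.lt_floor_add_one (2 ^ j * α)
  have hb1 := Nat.floor_le (a := 2 ^ j * β) (by positivity)
  have hb2 := Nat.lt_floor_add_one (2 ^ j * β)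
  rw [hfl] at ha1 ha2
  have h3 : 2 ^ j * |α - β| = |2 ^ j * α - 2 ^ j * β| := by
    rw [← mul_sub, abs_mul, abs_of_pos (by positivity : (0 : ℝ) < 2 ^ j)]
  rw [h3, lt_abs] at h2
  rcases h2 with h2 | h2 <;> linarith

end SimpleGraph

/-- given an infinite, locally finite, connected, vertex-transitive graph
`X`, there is a family `(G_α)_{α ∈ (0,1]}` of connected, 3-regular graphs such that
(i) for `α ≠ β`, `G_α` and `G_β` are not quasi-isometric, (ii) each `G_α` has the same
cardinality of ends as `X`, and (iii) each `G_α` has growth function equivalent to that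
of `X`. In particular, there are continuum many pairwise non-quasi-isometric 3-regular
graphs with the same growth rate and number of ends as `X`. -/
theorem stmt16 {V : Type} (G : SimpleGraph V) [Infinite V]
    (hlf : ∀ v : V, (G.neighborSet v).Finite) (hconn : G.Connected)
    (htrans : ∀ u v : V, ∃ φ : G ≃g G, φ u = v) :
    ∃ (W : ℝ → Type) (H : ∀ α : ℝ, SimpleGraph (W α)),
      (∀ α ∈ Set.Ioc (0 : ℝ) 1,
        (H α).Connected ∧ ∀ w : W α, ((H α).neighborSet w).ncard = 3) ∧
      (∀ α ∈ Set.Ioc (0 : ℝ) 1, ∀ β ∈ Set.Ioc (0 : ℝ) 1, α ≠ β →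
        ¬ ∃ (L A : ℝ) (f : W α → W β), 1 ≤ L ∧ 0 ≤ A ∧
          IsQIE (gdist (H α)) (gdist (H β)) L A f ∧ IsCoarselySurj (gdist (H β)) f) ∧
      (∀ α ∈ Set.Ioc (0 : ℝ) 1,
        Cardinal.mk ↥((H α).end) = Cardinal.mk ↥(G.end)) ∧
      (∀ α ∈ Set.Ioc (0 : ℝ) 1, ∀ v₀ : V, ∀ w₀ : W α, ∃ c : ℕ, 0 < c ∧ ∀ n : ℕ,
        (gball G v₀ n).ncard ≤ c * (gball (H α) w₀ (c * n + c)).ncard ∧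
        (gball (H α) w₀ n).ncard ≤ c * (gball G v₀ (c * n + c)).ncard) := by
  classical
  have o : V := Classical.choice inferInstance
  have hsph := hconn.exists_dist_eq hlf
  have hmid := SimpleGraph.isMidpoint_of_transitive hlf hconn htrans
  choose γ hγ using hsph o
  have hdeg : ∀ v, (G.neighborSet v).ncard ≤ (G.neighborSet o).ncard := fun v => by
    obtain ⟨φ, hφ⟩ := htrans v o
    refine Set.ncard_le_ncard_of_injOn φ (fun u hu => ?_) φ.injective.injOn (hlf o)
    rw [← hφ]
    exact φ.map_adj_iff.mpr hu
  set n := (G.neighborSet o).ncard + 2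
  let h : ℝ → V → ℕ := fun α =>
    SimpleGraph.hairs (fun m => γ (SimpleGraph.sparse m)) (SimpleGraph.dyadicCode α)
  let Y := fun α => SimpleGraph.comb G (h α)
  have hYlf : ∀ α y, ((Y α).neighborSet y).Finite := fun α =>
    SimpleGraph.finite_neighborSet_comb hlf
  have hpos := fun α => SimpleGraph.exists_positions (n := n) (hYlf α) fun y =>
    (SimpleGraph.ncard_neighborSet_comb_le hlf y).trans (Nat.add_le_add_right (hdeg _) 2)
  choose e he0 hinj using hpos
  have hY : ∀ α, (Y α).Connected := fun α => SimpleGraph.comb_connected hconn _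
  have hcomb := fun α => SimpleGraph.isContraction_comb G (h α)
  have hcub := fun α => SimpleGraph.isContraction_cubic (he0 α)
  have hK : ∀ α (y : {a : V × ℕ // a.2 ≤ h α a.1}),
      (Prod.fst ⁻¹' {y} : Set (_ × ZMod (n + 3) × Bool)).ncard ≤ (n + 3) * 2 := fun α y =>
    (SimpleGraph.ncard_fiber_cubic y).le
  refine ⟨fun α => {a : V × ℕ // a.2 ≤ h α a.1} × ZMod (n + 3) × Bool,
    fun α => SimpleGraph.cubic (Y α) n (e α), fun α _ => ⟨(hcub α).connected (hY α),
      SimpleGraph.ncard_neighborSet_cubic (hinj α)⟩, ?_,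
    fun α _ => ((hcomb α).comp (hcub α)).mk_end_eq, ?_⟩
  · rintro α hα β hβ hne ⟨L, A, f, hL, hA, hf, hs⟩
    obtain ⟨F, M, hM, hup, hlow, hsurj⟩ :=
      (hcub α).exists_qi (hcub β) (hY α) (hY β) (hK α) (hK β) hL hA hf hs
    obtain ⟨N, hN⟩ := SimpleGraph.exists_bound_mem_of_qi hconn hmid hsph
      (fun m => hγ (SimpleGraph.sparse m)) F hM hup hlow hsurj
    obtain ⟨m, hm, hNm, hm'⟩ :=
      SimpleGraph.exists_mem_dyadicCode_notMem hα.1.le hβ.1.le hne N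
    exact hm' (hN m hm hNm)
  · intro α _ v₀ w₀
    have hH := (hcub α).connected (hY α)
    set H := SimpleGraph.cubic (Y α) n (e α)
    let K := (n + 3) * 2
    let base : V → {a : V × ℕ // a.2 ≤ h α a.1} := fun v => ⟨(v, 0), Nat.zero_le _⟩
    let D := (Y α).dist w₀.1 (base v₀)
    let E := (Y α).dist (base o) w₀.1 + G.dist v₀ o
    refine ⟨(K + 1) * (D + 1) + 2 * K + E, by positivity, fun k => ⟨?_, ?_⟩⟩
    · refine le_trans ?_ (Nat.le_mul_of_pos_left _ (by positivity))
      refine Set.ncard_le_ncard_of_injOn (fun v => (base v, 0, false)) (fun v hv => ?_) ?_ ?_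
      · have h1 := (hcub α).dist_le_mul (hY α) (hK α) w₀ (base v, 0, false)
        have h2 := (hY α).dist_triangle (u := w₀.1) (v := base v₀) (w := base v)
        have h3 := SimpleGraph.dist_comb_base_le (h := h α) hconn v₀ v
        have h4 : G.dist v₀ v ≤ k := hv
        have h5 : (K + 1) * (Y α).dist w₀.1 (base v) ≤ (K + 1) * (D + k) :=
          Nat.mul_le_mul_left _ (h2.trans (Nat.add_le_add_left (h3.trans h4) _))
        refine h1.trans ((Nat.add_le_add_right h5 K).trans ?_)
        nlinarith [Nat.zero_le (E * k), Nat.zero_le (K * k), Nat.zero_le (D * k),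
          Nat.zero_le (K * D * k)]
      · intro u _ v _ huv
        have := (Prod.mk.inj huv).1
        exact congrArg (fun a => a.1.1) this
      · exact hH.finite_gball (fun w => Set.finite_of_ncard_ne_zero (by
          rw [SimpleGraph.ncard_neighborSet_cubic (hinj α)]; norm_num)) _ _
    · have h1 := (hcub α).ncard_gball_le (hY α) (hYlf α) (hK α) w₀ k
      have h2 : (gball (Y α) w₀.1 k).ncard ≤
          (gball (Y α) (base o) (k + (Y α).dist (base o) w₀.1)).ncard := by
        refine Set.ncard_le_ncard (fun a ha => ?_) ((hY α).finite_gball (hYlf α) _ _)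
        have := (hY α).dist_triangle (u := base o) (v := w₀.1) (w := a)
        have ha' : (Y α).dist w₀.1 a ≤ k := ha
        change (Y α).dist (base o) a ≤ _
        omega
      have h3 := SimpleGraph.ncard_gball_comb_le hconn hlf hγ (SimpleGraph.dyadicCode α)
        (k + (Y α).dist (base o) w₀.1)
      set c := (K + 1) * (D + 1) + 2 * K + E with hc
      have hEc : k + E ≤ c * k + c := by
        have : 0 < c := by rw [hc]; positivity
        nlinarith
      have h4 : (gball G o (k + (Y α).dist (base o) w₀.1)).ncard ≤
          (gball G v₀ (c * k + c)).ncard := by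
        refine Set.ncard_le_ncard (fun a ha => ?_) (hconn.finite_gball hlf _ _)
        have := hconn.dist_triangle (u := v₀) (v := o) (w := a)
        have ha' : G.dist o a ≤ k + (Y α).dist (base o) w₀.1 := ha
        change G.dist v₀ a ≤ _
        omega
      calc (gball H w₀ k).ncard ≤ K * (gball (Y α) w₀.1 k).ncard := h1
        _ ≤ K * (2 * (gball G v₀ (c * k + c)).ncard) :=
          Nat.mul_le_mul_left _ (h2.trans (h3.trans (Nat.mul_le_mul_left _ h4)))
        _ = 2 * K * (gball G v₀ (c * k + c)).ncard := by ring
        _ ≤ c * (gball G v₀ (c * k + c)).ncard := Nat.mul_le_mul_right _ (by omega)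
end
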